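/- arXiv:math/0307144 — 7 statements merged into one kernel-verified Lean document; each statement's English description precedes it below -/
import Mathlib

section
/- Let N ≥ 3, ρ > 0 and 1 < p ≤ N/(N-2). Then there is no positive classical supersolution of -Δu = u^p on the exterior domain {x ∈ ℝ^N : ‖x‖ > ρ}; that is, there is no function u : ℝ^N → ℝ which is C² on {x : ‖x‖ > ρ}, positive there, and satisfies -Δu(x) ≥ u(x)^p for all x with ‖x‖ > ρ. (This is the paper's Theorem 1.3 in the case Ω = S^{N-1}, where λ₁ = 0 and α₋ = 2-N; note that the critical exponent p = N/(N-2) is included in the nonexistence range.) -/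
/-- The Laplacian of `u : ℝ^N → ℝ`: the sum of its second partial derivatives. -/
noncomputable def lap {N : ℕ} (u : EuclideanSpace ℝ (Fin N) → ℝ)
    (x : EuclideanSpace ℝ (Fin N)) : ℝ :=
  ∑ i, fderiv ℝ (fun y => fderiv ℝ u y (EuclideanSpace.single i 1)) x (EuclideanSpace.single i 1)

open Set Filter Topology

/-- The second derivative of a function of one variable is nonnegative at a local minimum. -/
theorem deriv_deriv_nonneg_of_isLocalMin {g : ℝ → ℝ} {t : ℝ} (hg : ContinuousAt g t)
    (hmin : IsLocalMin g t) : 0 ≤ deriv (deriv g) t := by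
  by_contra! hneg
  have hmax := isLocalMax_of_deriv_deriv_neg hneg hmin.deriv_eq_zero hg
  have hconst : g =ᶠ[𝓝 t] fun _ => g t := by
    filter_upwards [hmin, hmax] with s h1 h2 using le_antisymm h2 h1
  have h := hconst.deriv.deriv_eq
  simp only [deriv_const'] at h
  simp [h] at hneg

theorem deriv_comp_add_smul {N : ℕ} {f : EuclideanSpace ℝ (Fin N) → ℝ}
    {x e : EuclideanSpace ℝ (Fin N)} {t : ℝ} (hf : DifferentiableAt ℝ f (x + t • e)) :
    deriv (fun s : ℝ => f (x + s • e)) t = fderiv ℝ f (x + t • e) e := by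
  have hline : HasDerivAt (fun s : ℝ => x + s • e) e t := by
    simpa using ((hasDerivAt_id t).smul_const e).const_add x
  exact (hf.hasFDerivAt.comp_hasDerivAt t hline).deriv

theorem fderiv_fderiv_nonneg_of_isLocalMin {N : ℕ} {f : EuclideanSpace ℝ (Fin N) → ℝ}
    {x : EuclideanSpace ℝ (Fin N)} (hf : ContDiffAt ℝ 2 f x) (hmin : IsLocalMin f x)
    (e : EuclideanSpace ℝ (Fin N)) : 0 ≤ fderiv ℝ (fun y => fderiv ℝ f y e) x e := by
  have hline : Tendsto (fun s : ℝ => x + s • e) (𝓝 0) (𝓝 x) := by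
    have : Continuous fun s : ℝ => x + s • e := by fun_prop
    simpa using this.tendsto 0
  have hdiff : ∀ᶠ y in 𝓝 x, DifferentiableAt ℝ f y := by
    filter_upwards [hf.eventually (by simp)] with y hy using hy.differentiableAt (by simp)
  have hderiv : deriv (fun s : ℝ => f (x + s • e)) =ᶠ[𝓝 0]
      fun s => fderiv ℝ f (x + s • e) e := by
    filter_upwards [hline.eventually hdiff] with s hs using deriv_comp_add_smul hs
  have hsecond : DifferentiableAt ℝ (fun y => fderiv ℝ f y e) x :=
    ((hf.fderiv_right (m := 1) (by norm_num)).differentiableAt (by simp)).clm_apply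
      (differentiableAt_const e)
  have hcont : ContinuousAt (fun s : ℝ => f (x + s • e)) 0 := by
    have : ContinuousAt f (x + (0 : ℝ) • e) := by simpa using hf.continuousAt
    exact this.comp (f := fun s : ℝ => x + s • e) (by fun_prop)
  have hlocal : IsLocalMin (fun s : ℝ => f (x + s • e)) 0 := by
    have := hline.eventually hmin
    simpa [IsLocalMin, IsMinFilter] using this
  have hnonneg := deriv_deriv_nonneg_of_isLocalMin hcont hlocal
  rw [hderiv.deriv_eq] at hnonneg
  have := deriv_comp_add_smul (f := fun y => fderiv ℝ f y e) (x := x) (e := e) (t := 0)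
    (by simpa using hsecond)
  simp only [zero_smul, add_zero] at this
  rwa [this] at hnonneg

theorem lap_le_lap_of_isLocalMin_sub {N : ℕ} {u v : EuclideanSpace ℝ (Fin N) → ℝ}
    {x : EuclideanSpace ℝ (Fin N)} (hu : ContDiffAt ℝ 2 u x) (hv : ContDiffAt ℝ 2 v x)
    (hmin : IsLocalMin (fun y => u y - v y) x) : lap v x ≤ lap u x := by
  refine Finset.sum_le_sum fun i _ => ?_
  set e : EuclideanSpace ℝ (Fin N) := EuclideanSpace.single i 1
  have hsecond {w : EuclideanSpace ℝ (Fin N) → ℝ} (hw : ContDiffAt ℝ 2 w x) :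
      DifferentiableAt ℝ (fun y => fderiv ℝ w y e) x :=
    ((hw.fderiv_right (m := 1) (by norm_num)).differentiableAt (by simp)).clm_apply
      (differentiableAt_const e)
  have hsub : (fun y => fderiv ℝ (fun z => u z - v z) y e) =ᶠ[𝓝 x]
      fun y => fderiv ℝ u y e - fderiv ℝ v y e := by
    filter_upwards [hu.eventually (by simp), hv.eventually (by simp)] with y hy hy'
    rw [fderiv_fun_sub (hy.differentiableAt (by simp)) (hy'.differentiableAt (by simp))]
    rfl
  have h := fderiv_fderiv_nonneg_of_isLocalMin (hu.sub hv) hmin e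
  rw [hsub.fderiv_eq, fderiv_fun_sub (hsecond hu) (hsecond hv)] at h
  exact sub_nonneg.mp h

/-- The weak maximum principle on a compact set, with a strict differential inequality. -/
theorem le_of_lap_lt_lap {N : ℕ} {u v : EuclideanSpace ℝ (Fin N) → ℝ}
    {K U : Set (EuclideanSpace ℝ (Fin N))} (hK : IsCompact K) (hU : IsOpen U) (hUK : U ⊆ K)
    (hu : ∀ x ∈ K, ContDiffAt ℝ 2 u x) (hv : ∀ x ∈ K, ContDiffAt ℝ 2 v x)
    (hlap : ∀ x ∈ U, lap u x < lap v x) (hbdry : ∀ x ∈ K \ U, v x ≤ u x) :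
    ∀ x ∈ K, v x ≤ u x := by
  intro x hx
  have hcont : ContinuousOn (fun y => u y - v y) K := fun y hy =>
    ((hu y hy).continuousAt.sub (hv y hy).continuousAt).continuousWithinAt
  obtain ⟨z, hzK, hz⟩ := hK.exists_isMinOn ⟨x, hx⟩ hcont
  have hzx : u z - v z ≤ u x - v x := hz hx
  by_cases hzU : z ∈ U
  · have hlocal : IsLocalMin (fun y => u y - v y) z :=
      hz.isLocalMin (mem_of_superset (hU.mem_nhds hzU) hUK)
    exact absurd (lap_le_lap_of_isLocalMin_sub (hu z hzK) (hv z hzK) hlocal)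
      (hlap z hzU).not_ge
  · linarith [hbdry z ⟨hzK, hzU⟩]

/-- The Laplacian of a function of the squared distance to a point. -/
theorem lap_comp_norm_sub_sq {N : ℕ} {g g' : ℝ → ℝ} {g'' : ℝ} {x y : EuclideanSpace ℝ (Fin N)}
    (hg : ∀ᶠ s in 𝓝 (‖x - y‖ ^ 2), HasDerivAt g (g' s) s)
    (hg' : HasDerivAt g' g'' (‖x - y‖ ^ 2)) :
    lap (fun z => g (‖z - y‖ ^ 2)) x =
      4 * ‖x - y‖ ^ 2 * g'' + 2 * N * g' (‖x - y‖ ^ 2) := by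
  have hsq (z : EuclideanSpace ℝ (Fin N)) :
      HasFDerivAt (fun z => ‖z - y‖ ^ 2) (2 • innerSL ℝ (z - y)) z := by
    simpa using ((hasFDerivAt_id z).sub_const y).norm_sq
  have hcomp {k : ℝ → ℝ} {k' : ℝ} {z : EuclideanSpace ℝ (Fin N)}
      (hk : HasDerivAt k k' (‖z - y‖ ^ 2)) :
      HasFDerivAt (fun z => k (‖z - y‖ ^ 2)) (k' • 2 • innerSL ℝ (z - y)) z :=
    hk.comp_hasFDerivAt z (hsq z)
  have hterm (i : Fin N) :
      fderiv ℝ (fun z => fderiv ℝ (fun z => g (‖z - y‖ ^ 2)) z (EuclideanSpace.single i 1)) x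
        (EuclideanSpace.single i 1) = 4 * g'' * (x - y) i ^ 2 + 2 * g' (‖x - y‖ ^ 2) := by
    have hev : (fun z => fderiv ℝ (fun z => g (‖z - y‖ ^ 2)) z (EuclideanSpace.single i 1))
        =ᶠ[𝓝 x] fun z => g' (‖z - y‖ ^ 2) * (2 * (z i - y i)) := by
      filter_upwards [(hsq x).continuousAt.eventually hg] with z hz
      rw [(hcomp hz).fderiv]
      simp [EuclideanSpace.inner_single_right]
    have hcoord : HasFDerivAt (fun z : EuclideanSpace ℝ (Fin N) => 2 * (z i - y i))
        ((2 : ℝ) • EuclideanSpace.proj (𝕜 := ℝ) i) x :=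
      (((EuclideanSpace.proj (𝕜 := ℝ) i).hasFDerivAt (x := x)).sub_const (y i)).const_mul 2
    rw [hev.fderiv_eq, ((hcomp hg').fun_mul hcoord).fderiv]
    simp [EuclideanSpace.inner_single_right]
    ring
  rw [lap, Finset.sum_congr rfl fun i _ => hterm i, Finset.sum_add_distrib, ← Finset.mul_sum,
    ← EuclideanSpace.real_norm_sq_eq]
  simp
  ring

theorem hasDerivAt_rpow_mul_log (b c ε : ℝ) {s : ℝ} (hs : 0 < s) :
    HasDerivAt (fun s => s ^ b * (c + ε * Real.log s))
      (s ^ (b - 1) * (b * c + ε + b * ε * Real.log s)) s := by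
  have h := (Real.hasDerivAt_rpow_const (p := b) (Or.inl hs.ne')).fun_mul
    (((Real.hasDerivAt_log hs.ne').const_mul ε).const_add c)
  refine h.congr_deriv ?_
  rw [Real.rpow_sub_one hs.ne']
  field_simp
  ring

/-- The Laplacian of a combination of `‖x‖ ^ (2 - N)` and `‖x‖ ^ (2 - N) * log ‖x‖`. -/
theorem lap_rpow_mul_log {N : ℕ} {a : ℝ} (ha : 2 * a = N - 2) (c ε δ : ℝ)
    {x : EuclideanSpace ℝ (Fin N)} (hx : x ≠ 0) :
    lap (fun z => (‖z‖ ^ 2) ^ (-a) * (c + ε * Real.log (‖z‖ ^ 2)) - δ) x =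
      -(4 * a * ε * (‖x‖ ^ 2) ^ (-a - 1)) := by
  have hq : 0 < ‖x‖ ^ 2 := by positivity
  have h := lap_comp_norm_sub_sq (x := x) (y := 0)
    (g := fun s => s ^ (-a) * (c + ε * Real.log s) - δ)
    (by
      simp only [sub_zero]
      filter_upwards [lt_mem_nhds hq] with s hs
        using (hasDerivAt_rpow_mul_log (-a) c ε hs).sub_const δ)
    (by simpa only [sub_zero] using
      hasDerivAt_rpow_mul_log (-a - 1) (-a * c + ε) (-a * ε) hq)
  simp only [sub_zero] at h
  rw [h, Real.rpow_sub_one hq.ne' (-a - 1)]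
  have hN : (N : ℝ) = 2 * a + 2 := by linarith
  rw [hN]
  field_simp
  ring

theorem tendsto_rpow_neg_mul_log {a : ℝ} (ha : 0 < a) (c ε : ℝ) :
    Tendsto (fun s : ℝ => s ^ (-a) * (c + ε * Real.log s)) atTop (𝓝 0) := by
  have h1 : Tendsto (fun s : ℝ => s ^ (-a)) atTop (𝓝 0) := tendsto_rpow_neg_atTop ha
  have h2 : Tendsto (fun s : ℝ => Real.log s / s ^ a) atTop (𝓝 0) :=
    (isLittleO_log_rpow_atTop ha).tendsto_div_nhds_zero
  have h := (h1.mul_const c).add (h2.const_mul ε)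
  simp only [zero_mul, mul_zero, add_zero] at h
  refine h.congr' ?_
  filter_upwards [eventually_gt_atTop 0] with s hs
  rw [Real.rpow_neg hs.le]
  field_simp

/-- Comparison of a nonnegative function with a radial barrier on an exterior domain. -/
theorem rpow_mul_log_le {N : ℕ} {u : EuclideanSpace ℝ (Fin N) → ℝ} {a c ε r : ℝ}
    (ha : 0 < a) (haN : 2 * a = N - 2) (hr : 0 < r)
    (hu : ∀ x, r ≤ ‖x‖ → ContDiffAt ℝ 2 u x) (hpos : ∀ x, r ≤ ‖x‖ → 0 ≤ u x)
    (hlap : ∀ x, r < ‖x‖ → lap u x < -(4 * a * ε * (‖x‖ ^ 2) ^ (-a - 1)))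
    (hbdry : ∀ x, ‖x‖ = r → (‖x‖ ^ 2) ^ (-a) * (c + ε * Real.log (‖x‖ ^ 2)) ≤ u x)
    {x : EuclideanSpace ℝ (Fin N)} (hx : r ≤ ‖x‖) :
    (‖x‖ ^ 2) ^ (-a) * (c + ε * Real.log (‖x‖ ^ 2)) ≤ u x := by
  refine le_of_forall_pos_le_add fun δ hδ => ?_
  have hlim := (tendsto_rpow_neg_mul_log ha c ε).comp (tendsto_pow_atTop (α := ℝ) two_ne_zero)
  obtain ⟨R, hR, hxR⟩ := ((hlim.eventually (gt_mem_nhds hδ)).and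
    (eventually_ge_atTop ‖x‖)).exists
  have hne {z : EuclideanSpace ℝ (Fin N)} (hz : r ≤ ‖z‖) : z ≠ 0 :=
    norm_pos_iff.mp (hr.trans_le hz)
  have hcompact : IsCompact {z : EuclideanSpace ℝ (Fin N) | r ≤ ‖z‖ ∧ ‖z‖ ≤ R} :=
    (isCompact_closedBall (0 : EuclideanSpace ℝ (Fin N)) R).of_isClosed_subset
      ((isClosed_le continuous_const continuous_norm).inter
        (isClosed_le continuous_norm continuous_const)) fun z hz => by simpa using hz.2
  have hopen : IsOpen {z : EuclideanSpace ℝ (Fin N) | r < ‖z‖ ∧ ‖z‖ < R} :=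
    (isOpen_lt continuous_const continuous_norm).inter
      (isOpen_lt continuous_norm continuous_const)
  have h := le_of_lap_lt_lap hcompact hopen (fun z hz => ⟨hz.1.le, hz.2.le⟩)
    (u := u) (v := fun z => (‖z‖ ^ 2) ^ (-a) * (c + ε * Real.log (‖z‖ ^ 2)) - δ)
    (fun z hz => hu z hz.1) (fun z hz => ?_) (fun z hz => ?_) (fun z hz => ?_) x ⟨hx, hxR⟩
  · linarith
  · have hsq : ContDiffAt ℝ 2 (fun z : EuclideanSpace ℝ (Fin N) => ‖z‖ ^ 2) z :=
      (contDiff_norm_sq ℝ).contDiffAt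
    have hz0 : ‖z‖ ^ 2 ≠ 0 := by simpa using hne hz.1
    exact ((hsq.rpow_const_of_ne hz0).mul
      (contDiffAt_const.add (contDiffAt_const.mul (hsq.log hz0)))).sub contDiffAt_const
  · rw [lap_rpow_mul_log haN c ε δ (hne hz.1.le)]
    exact hlap z hz.1
  · by_cases hzr : ‖z‖ = r
    · linarith [hbdry z hzr]
    · have hzR : ‖z‖ = R := by
        by_contra hzR
        exact hz.2 ⟨lt_of_le_of_ne hz.1.1 (Ne.symm hzr), lt_of_le_of_ne hz.1.2 hzR⟩
      simp only [Function.comp_apply] at hR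
      simp only [hzR]
      linarith [hpos z hz.1.1]

/-- A positive supersolution on a ball is somewhere bounded by a power of the radius. -/
theorem exists_rpow_mul_sq_le {N : ℕ} {u : EuclideanSpace ℝ (Fin N) → ℝ} {p R : ℝ}
    (hR : 0 < R) (y : EuclideanSpace ℝ (Fin N))
    (hu : ∀ x ∈ Metric.closedBall y R, ContDiffAt ℝ 2 u x)
    (hpos : ∀ x ∈ Metric.closedBall y R, 0 < u x)
    (hsuper : ∀ x ∈ Metric.closedBall y R, u x ^ p ≤ -lap u x) :
    ∃ x ∈ Metric.closedBall y R, u x ^ (p - 1) * R ^ 2 ≤ 2 * N * (N + 2) := by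
  have hcont : ContinuousOn (fun x => (R ^ 2 - ‖x - y‖ ^ 2) ^ 2 / u x)
      (Metric.closedBall y R) := by
    refine ContinuousOn.div (by fun_prop)
      (fun x hx => (hu x hx).continuousAt.continuousWithinAt) fun x hx => (hpos x hx).ne'
  have hy : y ∈ Metric.closedBall y R := Metric.mem_closedBall_self hR.le
  obtain ⟨x, hx, hmax⟩ := (isCompact_closedBall y R).exists_isMaxOn ⟨y, hy⟩ hcont
  refine ⟨x, hx, ?_⟩
  have hux := hpos x hx
  have hxR : ‖x - y‖ ≤ R := by simpa [dist_eq_norm] using hx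
  have hquot : 0 < (R ^ 2 - ‖x - y‖ ^ 2) ^ 2 / u x := by
    refine lt_of_lt_of_le ?_ (hmax hy)
    have := hpos y hy
    have : 0 < (R ^ 2) ^ 2 / u y := by positivity
    simpa using this
  have hball : ‖x - y‖ < R := by
    refine lt_of_le_of_ne hxR fun h => ?_
    simp [h] at hquot
  set w := R ^ 2 - ‖x - y‖ ^ 2 with hw
  have hwpos : 0 < w := by nlinarith [norm_nonneg (x - y)]
  set t := u x / w ^ 2 with ht
  have htpos : 0 < t := by positivity
  have htw : t * w ^ 2 = u x := by rw [ht]; field_simp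
  have hmin : IsLocalMin (fun z => u z - t * (R ^ 2 - ‖z - y‖ ^ 2) ^ 2) x := by
    filter_upwards [Metric.isOpen_ball.mem_nhds
      (show x ∈ Metric.ball y R by simpa [dist_eq_norm] using hball)] with z hz
    have hz' := Metric.ball_subset_closedBall hz
    have h : (R ^ 2 - ‖z - y‖ ^ 2) ^ 2 / u z ≤ w ^ 2 / u x := hmax hz'
    rw [div_le_div_iff₀ (hpos z hz') hux] at h
    rw [← hw, htw, sub_self, sub_nonneg, ht, div_mul_eq_mul_div, div_le_iff₀ (by positivity)]
    linarith
  have hsmooth : ContDiffAt ℝ 2 (fun z => t * (R ^ 2 - ‖z - y‖ ^ 2) ^ 2) x :=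
    (contDiff_const.mul ((contDiff_const.sub
      ((contDiff_id.sub contDiff_const).norm_sq ℝ)).pow 2)).contDiffAt
  have hle := lap_le_lap_of_isLocalMin_sub (hu x hx) hsmooth hmin
  have hg (s : ℝ) : HasDerivAt (fun s => t * (R ^ 2 - s) ^ 2) (t * (-2 * (R ^ 2 - s))) s := by
    refine (((hasDerivAt_id s).const_sub (R ^ 2)).fun_pow 2).const_mul t |>.congr_deriv ?_
    simp
  have hg' (s : ℝ) : HasDerivAt (fun s => t * (-2 * (R ^ 2 - s))) (2 * t) s := by
    refine (((hasDerivAt_id s).const_sub (R ^ 2)).const_mul (-2)).const_mul t |>.congr_deriv ?_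
    ring
  rw [lap_comp_norm_sub_sq (Eventually.of_forall hg) (hg' _), ← hw] at hle
  have hP : 0 < u x ^ (p - 1) := Real.rpow_pos_of_pos hux _
  have hsplit : u x ^ p = t * w ^ 2 * u x ^ (p - 1) := by
    rw [htw, Real.rpow_sub_one hux.ne']
    field_simp
  have hineq : t * (w ^ 2 * u x ^ (p - 1)) ≤ t * (4 * N * w - 8 * ‖x - y‖ ^ 2) := by
    linarith [hsuper x hx]
  have hineq' := le_of_mul_le_mul_left hineq htpos
  have hPw : u x ^ (p - 1) * w ≤ 4 * N := by
    refine le_of_mul_le_mul_left ?_ hwpos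
    nlinarith [sq_nonneg ‖x - y‖]
  have hwR : 2 * R ^ 2 ≤ w * (N + 2) := by
    have : 0 < w ^ 2 * u x ^ (p - 1) := by positivity
    linarith
  nlinarith [mul_le_mul_of_nonneg_left hwR hP.le,
    mul_le_mul_of_nonneg_right hPw (show (0 : ℝ) ≤ N + 2 by positivity)]

/-- For `N ≥ 3`, `ρ > 0` and `1 < p ≤ N/(N-2)` there is no positive classical
supersolution of `-Δu = u^p` on the exterior domain `{‖x‖ > ρ}`. -/
theorem no_positive_supersolution_exterior
    (N : ℕ) (hN : 3 ≤ N) (ρ : ℝ) (hρ : 0 < ρ) (p : ℝ)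
    (hp1 : 1 < p) (hp2 : p ≤ (N : ℝ) / ((N : ℝ) - 2)) :
    ¬ ∃ u : EuclideanSpace ℝ (Fin N) → ℝ,
        ContDiffOn ℝ 2 u {x | ρ < ‖x‖} ∧
        (∀ x : EuclideanSpace ℝ (Fin N), ρ < ‖x‖ → 0 < u x) ∧
        (∀ x : EuclideanSpace ℝ (Fin N), ρ < ‖x‖ → -lap u x ≥ u x ^ p) := by
  rintro ⟨u, hC, hpos, hsuper⟩
  have hN' : (3 : ℝ) ≤ N := by exact_mod_cast hN
  obtain ⟨a, haN⟩ : ∃ a : ℝ, 2 * a = N - 2 := ⟨(N - 2) / 2, by ring⟩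
  have ha : 0 < a := by linarith
  have hap : a * (p - 1) ≤ 1 := by
    rw [le_div_iff₀ (by linarith), ← haN] at hp2
    linarith
  have hu (x : EuclideanSpace ℝ (Fin N)) (hx : ρ < ‖x‖) : ContDiffAt ℝ 2 u x :=
    hC.contDiffAt ((isOpen_lt continuous_const continuous_norm).mem_nhds hx)
  have hsphere (R : ℝ) (hR : 0 ≤ R) : ∃ y : EuclideanSpace ℝ (Fin N), ‖y‖ = R :=
    ⟨EuclideanSpace.single ⟨0, by omega⟩ R, by simp [abs_of_nonneg hR]⟩
  obtain ⟨r, hrρ, hr1⟩ : ∃ r : ℝ, ρ < r ∧ 1 ≤ r :=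
    ⟨max (ρ + 1) 1, by simp, le_max_right _ _⟩
  have hr0 : 0 < r := by linarith
  obtain ⟨c, hc, hcu⟩ : ∃ c > 0, ∀ x : EuclideanSpace ℝ (Fin N), r ≤ ‖x‖ →
      c * (‖x‖ ^ 2) ^ (-a) ≤ u x := by
    obtain ⟨y, hy⟩ := hsphere r hr0.le
    obtain ⟨z, hz, hmin⟩ := (isCompact_sphere (0 : EuclideanSpace ℝ (Fin N)) r).exists_isMinOn
      ⟨y, by simpa using hy⟩ (f := u) fun x hx =>
        (hu x (by simp at hx; linarith)).continuousAt.continuousWithinAt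
    have hzρ : ρ < ‖z‖ := by simp at hz; linarith
    refine ⟨u z * (r ^ 2) ^ a, by have := hpos z hzρ; positivity, fun x hx => ?_⟩
    have h := rpow_mul_log_le (u := u) (c := u z * (r ^ 2) ^ a) (ε := 0) ha haN hr0
      (fun x hx => hu x (by linarith)) (fun x hx => (hpos x (by linarith)).le)
      (fun x hx => ?_) (fun x hx => ?_) hx
    · linarith
    · have := Real.rpow_pos_of_pos (hpos x (by linarith)) p
      linarith [hsuper x (by linarith)]
    · rw [hx, Real.rpow_neg (by positivity), zero_mul, add_zero]
      have := Real.rpow_pos_of_pos (show 0 < r ^ 2 by positivity) a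
      field_simp
      exact hmin (by simpa using hx)
  obtain ⟨ε, hε, hεc⟩ : ∃ ε > 0, 4 * a * ε < c ^ p := by
    have := Real.rpow_pos_of_pos hc p
    exact ⟨c ^ p / (8 * a), by positivity, by field_simp; linarith⟩
  have hlog (x : EuclideanSpace ℝ (Fin N)) (hx : r ≤ ‖x‖) :
      (‖x‖ ^ 2) ^ (-a) * (-ε * Real.log (r ^ 2) + ε * Real.log (‖x‖ ^ 2)) ≤ u x := by
    refine rpow_mul_log_le ha haN hr0 (fun x hx => hu x (by linarith))
      (fun x hx => (hpos x (by linarith)).le) (fun x hx => ?_) (fun x hx => ?_) hx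
    · have hq : 1 ≤ ‖x‖ ^ 2 := one_le_pow₀ (by linarith)
      have hq0 : 0 < ‖x‖ ^ 2 := by linarith
      have h1 : 4 * a * ε * (‖x‖ ^ 2) ^ (-a - 1) < c ^ p * (‖x‖ ^ 2) ^ (-a - 1) :=
        mul_lt_mul_of_pos_right hεc (Real.rpow_pos_of_pos hq0 _)
      have h2 : (‖x‖ ^ 2) ^ (-a - 1) ≤ (‖x‖ ^ 2) ^ (-a * p) :=
        Real.rpow_le_rpow_of_exponent_le hq (by linarith)
      have h3 : (c * (‖x‖ ^ 2) ^ (-a)) ^ p ≤ u x ^ p :=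
        Real.rpow_le_rpow (by positivity) (hcu x hx.le) (by linarith)
      rw [Real.mul_rpow hc.le (by positivity), ← Real.rpow_mul hq0.le] at h3
      have h4 := mul_le_mul_of_nonneg_left h2 (show 0 ≤ c ^ p by positivity)
      linarith [hsuper x (by linarith)]
    · rw [hx]
      simpa using (hpos x (by linarith)).le
  have hbound : ∀ R, r < R →
      (ε * (Real.log (R ^ 2) - Real.log (r ^ 2))) ^ (p - 1) ≤ 18 * N * (N + 2) := by
    intro R hR
    have hR0 : 0 < R := by linarith
    obtain ⟨y, hy⟩ := hsphere (2 * R) (by linarith)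
    have hball {x : EuclideanSpace ℝ (Fin N)} (hx : x ∈ Metric.closedBall y R) :
        R ≤ ‖x‖ ∧ ‖x‖ ≤ 3 * R := by
      rw [mem_closedBall_iff_norm] at hx
      have h1 := norm_sub_norm_le y x
      have h2 := norm_sub_norm_le x y
      rw [norm_sub_rev] at h1
      constructor <;> linarith
    obtain ⟨x, hx, hle⟩ := exists_rpow_mul_sq_le (u := u) (p := p) hR0 y
      (fun x hx => hu x (by linarith [hball hx])) (fun x hx => hpos x (by linarith [hball hx]))
      (fun x hx => hsuper x (by linarith [hball hx]))
    obtain ⟨hRx, hxR⟩ := hball hx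
    have hq : 1 ≤ ‖x‖ ^ 2 := one_le_pow₀ (by linarith)
    have hq0 : 0 < ‖x‖ ^ 2 := by linarith
    have hq9 : ‖x‖ ^ 2 ≤ 9 * R ^ 2 := by nlinarith
    set L := ε * (Real.log (R ^ 2) - Real.log (r ^ 2)) with hL
    have hLpos : 0 < L := mul_pos hε (sub_pos.mpr (Real.log_lt_log (by positivity) (by gcongr)))
    have hLx : L ≤ -ε * Real.log (r ^ 2) + ε * Real.log (‖x‖ ^ 2) := by
      have := Real.log_le_log (show 0 < R ^ 2 by positivity)
        (show R ^ 2 ≤ ‖x‖ ^ 2 by gcongr)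
      nlinarith
    have hux : (‖x‖ ^ 2) ^ (-a) * L ≤ u x :=
      (mul_le_mul_of_nonneg_left hLx (by positivity)).trans (hlog x (by linarith))
    have hpow : ((‖x‖ ^ 2) ^ (-a) * L) ^ (p - 1) ≤ u x ^ (p - 1) :=
      Real.rpow_le_rpow (by positivity) hux (by linarith)
    rw [Real.mul_rpow (by positivity) hLpos.le, ← Real.rpow_mul hq0.le] at hpow
    have hexp : (‖x‖ ^ 2)⁻¹ ≤ (‖x‖ ^ 2) ^ (-a * (p - 1)) := by
      rw [← Real.rpow_neg_one]
      exact Real.rpow_le_rpow_of_exponent_le hq (by linarith)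
    have hLp : 0 < L ^ (p - 1) := Real.rpow_pos_of_pos hLpos _
    have h1 : L ^ (p - 1) ≤ u x ^ (p - 1) * ‖x‖ ^ 2 := by
      have := (mul_le_mul_of_nonneg_right hexp hLp.le).trans hpow
      rwa [inv_mul_le_iff₀ hq0, mul_comm] at this
    have h2 : u x ^ (p - 1) * ‖x‖ ^ 2 ≤ u x ^ (p - 1) * (9 * R ^ 2) :=
      mul_le_mul_of_nonneg_left hq9 (Real.rpow_nonneg (hpos x (by linarith)).le _)
    linarith
  have hlim : Tendsto (fun R : ℝ => (ε * (Real.log (R ^ 2) - Real.log (r ^ 2))) ^ (p - 1))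
      atTop atTop := by
    refine (tendsto_rpow_atTop (by linarith)).comp (Tendsto.const_mul_atTop hε ?_)
    simp only [sub_eq_add_neg]
    exact tendsto_atTop_add_const_right _ _
      (Real.tendsto_log_atTop.comp (tendsto_pow_atTop two_ne_zero))
  obtain ⟨R, hR, hrR⟩ := ((hlim.eventually_gt_atTop (18 * N * (N + 2))).and
    (eventually_gt_atTop r)).exists
  exact (hbound R hrR).not_gt hR
end

section
/- Let N ≥ 3, ρ > 0 and 1 < p ≤ (N+1)/(N-1). Then there is no positive classical supersolution of -Δu = u^p on C₊ ∩ {x : ‖x‖ > ρ}; that is, there is no function u : ℝ^N → ℝ which is C² on {x : x_N > 0, ‖x‖ > ρ}, positive there, and satisfies -Δu(x) ≥ u(x)^p for all x in that set. (This is the paper's Theorem 1.3 in the case where Ω is the open upper hemisphere of S^{N-1}: there λ₁ = N-1, α₋ = -(N-1), and the critical exponent p* = 1 - 2/α₋ = (N+1)/(N-1) is included in the nonexistence range.) -/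
/-- The last coordinate `x_N` of `x ∈ ℝ^N`. -/
def lastCoord {N : ℕ} (x : EuclideanSpace ℝ (Fin N)) : ℝ :=
  if h : 0 < N then x ⟨N - 1, Nat.sub_lt h Nat.one_pos⟩ else 0

theorem deriv_deriv_nonneg_of_isLocalMin_s2 {f : ℝ → ℝ} {a : ℝ} (h : IsLocalMin f a)
    (hc : ContinuousAt f a) : 0 ≤ deriv (deriv f) a := by
  by_contra! hneg
  have hmax : IsLocalMax f a := by
    have h1 : IsLocalMin (-f) a := by
      apply isLocalMin_of_deriv_deriv_pos
      · have : deriv (-f) = -deriv f := by ext; simp [deriv.neg]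
        rw [this, deriv.neg]; simpa using hneg
      · simp [deriv.neg, h.deriv_eq_zero]
      · exact hc.neg
    simpa using h1.neg
  have heq : f =ᶠ[nhds a] fun _ => f a := by
    filter_upwards [h, hmax] with x h1 h2 using le_antisymm h2 h1
  have : deriv (deriv f) a = 0 := by
    rw [heq.deriv.deriv_eq]; simp
  linarith

section Laplacian

variable {N : ℕ}

theorem ContDiffAt.differentiableAt_fderiv_apply {f : EuclideanSpace ℝ (Fin N) → ℝ}
    {x : EuclideanSpace ℝ (Fin N)} (hf : ContDiffAt ℝ 2 f x) (e : EuclideanSpace ℝ (Fin N)) :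
    DifferentiableAt ℝ (fun y => fderiv ℝ f y e) x :=
  ((hf.fderiv_right (m := 1) (by norm_num)).differentiableAt (by norm_num)).clm_apply
    (differentiableAt_const _)

theorem ContDiffAt.eventually_differentiableAt {f : EuclideanSpace ℝ (Fin N) → ℝ}
    {x : EuclideanSpace ℝ (Fin N)} (hf : ContDiffAt ℝ 2 f x) :
    ∀ᶠ y in nhds x, DifferentiableAt ℝ f y := by
  filter_upwards [hf.eventually (by simp)] with y hy using hy.differentiableAt (by norm_num)

theorem lap_nonneg_of_isLocalMin {f : EuclideanSpace ℝ (Fin N) → ℝ}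
    {x : EuclideanSpace ℝ (Fin N)} (hf : ContDiffAt ℝ 2 f x) (h : IsLocalMin f x) :
    0 ≤ lap f x := by
  refine Finset.sum_nonneg fun i _ => ?_
  set e : EuclideanSpace ℝ (Fin N) := EuclideanSpace.single i 1
  have hline : ∀ t : ℝ, HasDerivAt (fun t : ℝ => x + t • e) e t := fun t => by
    simpa using ((hasDerivAt_id t).smul_const e).const_add x
  have hx : x + (0 : ℝ) • e = x := by simp
  have htend : Filter.Tendsto (fun t : ℝ => x + t • e) (nhds 0) (nhds x) := by
    have := (hline 0).continuousAt.tendsto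
    rwa [hx] at this
  have hmin : IsLocalMin (fun t : ℝ => f (x + t • e)) 0 := by
    have := htend.eventually h
    simpa [IsLocalMin, IsMinFilter] using this
  have hd1 : deriv (fun t : ℝ => f (x + t • e)) =ᶠ[nhds 0] fun t => fderiv ℝ f (x + t • e) e := by
    filter_upwards [htend.eventually hf.eventually_differentiableAt] with t ht
    exact (ht.hasFDerivAt.comp_hasDerivAt t (hline t)).deriv
  have hd2 : deriv (deriv fun t : ℝ => f (x + t • e)) 0
      = fderiv ℝ (fun y => fderiv ℝ f y e) x e := by
    rw [hd1.deriv_eq]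
    have h2 : HasFDerivAt (fun y => fderiv ℝ f y e) (fderiv ℝ (fun y => fderiv ℝ f y e) x)
        (x + (0 : ℝ) • e) := by
      rw [hx]; exact (hf.differentiableAt_fderiv_apply e).hasFDerivAt
    exact (h2.comp_hasDerivAt (0 : ℝ) (hline 0)).deriv
  rw [← hd2]
  refine deriv_deriv_nonneg_of_isLocalMin_s2 hmin ?_
  have : ContinuousAt f (x + (0 : ℝ) • e) := by rw [hx]; exact hf.continuousAt
  exact ContinuousAt.comp (g := f) this (hline 0).continuousAt

theorem lap_add {f g : EuclideanSpace ℝ (Fin N) → ℝ} {x : EuclideanSpace ℝ (Fin N)}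
    (hf : ContDiffAt ℝ 2 f x) (hg : ContDiffAt ℝ 2 g x) :
    lap (fun y => f y + g y) x = lap f x + lap g x := by
  simp only [lap, ← Finset.sum_add_distrib]
  refine Finset.sum_congr rfl fun i _ => ?_
  have h : (fun y => fderiv ℝ (fun y => f y + g y) y (EuclideanSpace.single i 1)) =ᶠ[nhds x]
      fun y => fderiv ℝ f y (EuclideanSpace.single i 1)
        + fderiv ℝ g y (EuclideanSpace.single i 1) := by
    filter_upwards [hf.eventually_differentiableAt, hg.eventually_differentiableAt] with y h1 h2
    rw [fderiv_fun_add h1 h2]; rfl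
  rw [h.fderiv_eq, fderiv_fun_add (hf.differentiableAt_fderiv_apply _)
    (hg.differentiableAt_fderiv_apply _)]
  rfl

theorem lap_neg (f : EuclideanSpace ℝ (Fin N) → ℝ) (x : EuclideanSpace ℝ (Fin N)) :
    lap (fun y => -f y) x = -lap f x := by
  simp [lap, fderiv_fun_neg]

theorem lap_sub {f g : EuclideanSpace ℝ (Fin N) → ℝ} {x : EuclideanSpace ℝ (Fin N)}
    (hf : ContDiffAt ℝ 2 f x) (hg : ContDiffAt ℝ 2 g x) :
    lap (fun y => f y - g y) x = lap f x - lap g x := by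
  simpa only [sub_eq_add_neg, lap_neg] using lap_add hf hg.neg

theorem lap_comp_add_right (f : EuclideanSpace ℝ (Fin N) → ℝ) (a x : EuclideanSpace ℝ (Fin N)) :
    lap (fun y => f (y + a)) x = lap f (x + a) := by
  refine Finset.sum_congr rfl fun i _ => ?_
  simp only [fderiv_comp_add_right]
  rw [fderiv_comp_add_right (f := fun y => fderiv ℝ f y (EuclideanSpace.single i 1))]

theorem hasFDerivAt_comp_norm_sq {F : ℝ → ℝ} {F' : ℝ} {x : EuclideanSpace ℝ (Fin N)}
    (h : HasDerivAt F F' (‖x‖ ^ 2)) :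
    HasFDerivAt (fun y : EuclideanSpace ℝ (Fin N) => F (‖y‖ ^ 2))
      (F' • (2 • innerSL ℝ x)) x :=
  h.comp_hasFDerivAt x (hasStrictFDerivAt_norm_sq x).hasFDerivAt

theorem hasFDerivAt_coord_pow (j : Fin N) (k : ℕ) (x : EuclideanSpace ℝ (Fin N)) :
    HasFDerivAt (fun y : EuclideanSpace ℝ (Fin N) => y j ^ k)
      ((k * x j ^ (k - 1)) • (EuclideanSpace.proj j : EuclideanSpace ℝ (Fin N) →L[ℝ] ℝ)) x :=
  (hasDerivAt_pow k (x j)).comp_hasFDerivAt x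
    (EuclideanSpace.proj j : EuclideanSpace ℝ (Fin N) →L[ℝ] ℝ).hasFDerivAt

theorem lap_coord_pow_mul_radial (j : Fin N) (k : ℕ) {F F₁ : ℝ → ℝ} {F₂ : ℝ}
    {x : EuclideanSpace ℝ (Fin N)} (h₁ : ∀ᶠ t in nhds (‖x‖ ^ 2), HasDerivAt F (F₁ t) t)
    (h₂ : HasDerivAt F₁ F₂ (‖x‖ ^ 2)) :
    lap (fun y => y j ^ k * F (‖y‖ ^ 2)) x
      = k * (k - 1 : ℕ) * x j ^ (k - 2) * F (‖x‖ ^ 2)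
        + x j ^ k * (4 * ‖x‖ ^ 2 * F₂ + (2 * N + 4 * k) * F₁ (‖x‖ ^ 2)) := by
  have hcont : Filter.Tendsto (fun y : EuclideanSpace ℝ (Fin N) => ‖y‖ ^ 2) (nhds x)
      (nhds (‖x‖ ^ 2)) := (by fun_prop : Continuous fun y : EuclideanSpace ℝ (Fin N) =>
        ‖y‖ ^ 2).continuousAt.tendsto
  have hterm : ∀ i : Fin N, fderiv ℝ (fun y => fderiv ℝ (fun y : EuclideanSpace ℝ (Fin N) =>
        y j ^ k * F (‖y‖ ^ 2)) y (EuclideanSpace.single i 1)) x (EuclideanSpace.single i 1)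
      = (if i = j then k * (k - 1 : ℕ) * x j ^ (k - 2) * F (‖x‖ ^ 2)
          + 4 * k * x j ^ (k - 1) * x j * F₁ (‖x‖ ^ 2) else 0)
        + x j ^ k * (4 * F₂ * x i ^ 2 + 2 * F₁ (‖x‖ ^ 2)) := by
    intro i
    have hev : (fun y => fderiv ℝ (fun y : EuclideanSpace ℝ (Fin N) => y j ^ k * F (‖y‖ ^ 2)) y
        (EuclideanSpace.single i 1)) =ᶠ[nhds x] fun y =>
          (y j ^ (k - 1) * F (‖y‖ ^ 2)) * (if i = j then (k : ℝ) else 0)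
            + (y j ^ k * F₁ (‖y‖ ^ 2)) * (2 * y i ^ 1) := by
      filter_upwards [hcont.eventually h₁] with y hy
      rw [((hasFDerivAt_coord_pow j k y).fun_mul (hasFDerivAt_comp_norm_sq hy)).fderiv]
      by_cases hij : i = j
      · subst hij
        simp [EuclideanSpace.inner_single_right]; ring
      · simp [EuclideanSpace.inner_single_right, hij, Ne.symm hij]; ring
    rw [hev.fderiv_eq, ((((hasFDerivAt_coord_pow j (k - 1) x).fun_mul
      (hasFDerivAt_comp_norm_sq h₁.self_of_nhds)).mul_const (if i = j then (k : ℝ) else 0)).fun_add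
      (((hasFDerivAt_coord_pow j k x).fun_mul (hasFDerivAt_comp_norm_sq h₂)).fun_mul
        ((hasFDerivAt_coord_pow i 1 x).const_mul 2))).fderiv]
    by_cases hij : i = j
    · subst hij
      simp [EuclideanSpace.inner_single_right, Nat.sub_sub]; ring
    · simp [EuclideanSpace.inner_single_right, hij, Ne.symm hij]; ring
  have hk : (k : ℝ) * x j ^ (k - 1) * x j = k * x j ^ k := by
    rcases k with _ | k
    · simp
    · rw [Nat.add_sub_cancel]; ring
  rw [lap, Finset.sum_congr rfl fun i _ => hterm i, Finset.sum_add_distrib, ← Finset.mul_sum,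
    Finset.sum_add_distrib, ← Finset.mul_sum, ← EuclideanSpace.real_norm_sq_eq]
  simp only [Finset.sum_ite_eq', Finset.mem_univ, if_true, Finset.sum_const, Finset.card_univ,
    Fintype.card_fin, nsmul_eq_mul]
  linear_combination 4 * F₁ (‖x‖ ^ 2) * hk

theorem contDiffAt_coord_pow_mul_radial (j : Fin N) (k : ℕ) {F : ℝ → ℝ}
    {x : EuclideanSpace ℝ (Fin N)} (h : ContDiffAt ℝ 2 F (‖x‖ ^ 2)) :
    ContDiffAt ℝ 2 (fun y : EuclideanSpace ℝ (Fin N) => y j ^ k * F (‖y‖ ^ 2)) x := by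
  have h1 : ContDiffAt ℝ 2 (fun y : EuclideanSpace ℝ (Fin N) => y j) x :=
    (EuclideanSpace.proj j : EuclideanSpace ℝ (Fin N) →L[ℝ] ℝ).contDiff.contDiffAt
  exact (h1.pow k).mul (ContDiffAt.comp x h (contDiff_norm_sq ℝ).contDiffAt)

end Laplacian

section HalfSpace

variable {N : ℕ}

theorem coord_sq_le_norm_sq (j : Fin N) (x : EuclideanSpace ℝ (Fin N)) :
    x j ^ 2 ≤ ‖x‖ ^ 2 := by
  rw [EuclideanSpace.real_norm_sq_eq]
  exact Finset.single_le_sum (f := fun i => x i ^ 2) (fun i _ => sq_nonneg _) (Finset.mem_univ j)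

theorem isClosed_coord_nonneg (j : Fin N) :
    IsClosed {x : EuclideanSpace ℝ (Fin N) | 0 ≤ x j} :=
  isClosed_le continuous_const (EuclideanSpace.proj j : EuclideanSpace ℝ (Fin N) →L[ℝ] ℝ).continuous

theorem nonneg_of_lap_neg (j : Fin N) {f : EuclideanSpace ℝ (Fin N) → ℝ} {R : ℝ}
    (hf : ∀ x : EuclideanSpace ℝ (Fin N), 0 ≤ x j → 1 ≤ ‖x‖ → ContDiffAt ℝ 2 f x)
    (hlap : ∀ x : EuclideanSpace ℝ (Fin N), 0 < x j → 1 < ‖x‖ → lap f x < 0)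
    (hinner : ∀ x : EuclideanSpace ℝ (Fin N), 0 ≤ x j → ‖x‖ = 1 → 0 ≤ f x)
    (houter : ∀ x : EuclideanSpace ℝ (Fin N), 0 ≤ x j → ‖x‖ = R → 0 ≤ f x)
    (hflat : ∀ x : EuclideanSpace ℝ (Fin N), x j = 0 → 1 ≤ ‖x‖ → 0 ≤ f x)
    {x : EuclideanSpace ℝ (Fin N)} (hx : 0 ≤ x j) (hx1 : 1 ≤ ‖x‖) (hxR : ‖x‖ ≤ R) : 0 ≤ f x := by
  set K : Set (EuclideanSpace ℝ (Fin N)) := {y | 0 ≤ y j} ∩ ({y | 1 ≤ ‖y‖} ∩ {y | ‖y‖ ≤ R})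
    with hKdef
  have hK : IsCompact K := by
    refine (isCompact_closedBall (0 : EuclideanSpace ℝ (Fin N)) R).of_isClosed_subset
      ((isClosed_coord_nonneg j).inter ((isClosed_le continuous_const continuous_norm).inter
        (isClosed_le continuous_norm continuous_const))) fun y hy => ?_
    simpa using hy.2.2
  have hcont : ContinuousOn f K := fun y hy =>
    (hf y hy.1 hy.2.1).continuousAt.continuousWithinAt
  obtain ⟨z, hz, hmin⟩ := hK.exists_isMinOn ⟨x, hx, hx1, hxR⟩ hcont
  refine le_trans ?_ (hmin (show x ∈ K from ⟨hx, hx1, hxR⟩))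
  obtain ⟨hz0 : 0 ≤ z j, hz1 : 1 ≤ ‖z‖, hzR : ‖z‖ ≤ R⟩ := hz
  rcases hz0.eq_or_lt with h | h0
  · exact hflat z h.symm hz1
  rcases hz1.eq_or_lt with h | h1
  · exact hinner z hz0 h.symm
  rcases hzR.eq_or_lt with h | hR
  · exact houter z hz0 h
  have hnhds : K ∈ nhds z := by
    have ho : IsOpen ({y : EuclideanSpace ℝ (Fin N) | 0 < y j} ∩ ({y | 1 < ‖y‖} ∩ {y | ‖y‖ < R})) :=
      (isOpen_lt continuous_const
        (EuclideanSpace.proj j : EuclideanSpace ℝ (Fin N) →L[ℝ] ℝ).continuous).inter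
        ((isOpen_lt continuous_const continuous_norm).inter
          (isOpen_lt continuous_norm continuous_const))
    exact Filter.mem_of_superset (ho.mem_nhds ⟨h0, h1, hR⟩) fun y hy =>
      ⟨show 0 ≤ y j from le_of_lt hy.1, show 1 ≤ ‖y‖ from le_of_lt hy.2.1,
        show ‖y‖ ≤ R from le_of_lt hy.2.2⟩
  exact absurd (lap_nonneg_of_isLocalMin (hf z hz0 hz1) (hmin.isLocalMin hnhds))
    (not_le.mpr (hlap z h0 h1))

/-- Comparison functions on the half-space: with `μ = -N / 2`, the part with coefficient `α` is the
Poisson kernel `x_j / ‖x‖ ^ N`, and `b` corrects the angular dependence of the Laplacian of the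
logarithmic part. -/
noncomputable def barrier (j : Fin N) (α a b ε : ℝ) (x : EuclideanSpace ℝ (Fin N)) : ℝ :=
  x j ^ 1 * ((‖x‖ ^ 2) ^ (-N / 2 : ℝ) * (α + a * Real.log (‖x‖ ^ 2)) - ε)
    + x j ^ 3 * (b * (‖x‖ ^ 2) ^ (-N / 2 - 1 : ℝ))

theorem hasDerivAt_rpow_mul_add_log (μ α a : ℝ) {t : ℝ} (ht : 0 < t) :
    HasDerivAt (fun s => s ^ μ * (α + a * Real.log s))
      (t ^ (μ - 1) * (μ * α + a + μ * a * Real.log t)) t := by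
  have h := (Real.hasDerivAt_rpow_const (p := μ) (Or.inl ht.ne')).fun_mul
    (((Real.hasDerivAt_log ht.ne').const_mul a).const_add α)
  refine h.congr_deriv ?_
  rw [Real.rpow_sub_one ht.ne']
  field_simp
  ring

theorem contDiffAt_barrier (j : Fin N) (α a b ε : ℝ) {x : EuclideanSpace ℝ (Fin N)}
    (hx : x ≠ 0) : ContDiffAt ℝ 2 (barrier j α a b ε) x := by
  have hq : ‖x‖ ^ 2 ≠ 0 := by positivity
  refine (contDiffAt_coord_pow_mul_radial j 1
    (F := fun t => t ^ (-N / 2 : ℝ) * (α + a * Real.log t) - ε) ?_).add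
    (contDiffAt_coord_pow_mul_radial j 3 (F := fun t => b * t ^ (-N / 2 - 1 : ℝ)) ?_)
  · exact ((Real.contDiffAt_rpow_const_of_ne hq).mul (contDiffAt_const.add
      (contDiffAt_const.mul (Real.contDiffAt_log.2 hq)))).sub contDiffAt_const
  · exact contDiffAt_const.mul (Real.contDiffAt_rpow_const_of_ne hq)

theorem lap_barrier (j : Fin N) (α a b ε : ℝ) {x : EuclideanSpace ℝ (Fin N)} (hx : x ≠ 0) :
    lap (barrier j α a b ε) x
      = x j * (‖x‖ ^ 2) ^ (-N / 2 - 1 : ℝ) * (6 * b - 2 * N * a)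
        - (2 * N + 4) * b * x j ^ 3 * (‖x‖ ^ 2) ^ (-N / 2 - 2 : ℝ) := by
  have hq : 0 < ‖x‖ ^ 2 := by positivity
  have hq0 := hq.ne'
  set μ : ℝ := -N / 2 with hμ
  have hN : (N : ℝ) = -2 * μ := by rw [hμ]; ring
  have e1 : ContDiffAt ℝ 2 (fun t : ℝ => t ^ μ * (α + a * Real.log t) - ε) (‖x‖ ^ 2) :=
    ((Real.contDiffAt_rpow_const_of_ne hq0).mul (contDiffAt_const.add
      (contDiffAt_const.mul (Real.contDiffAt_log.2 hq0)))).sub contDiffAt_const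
  have e2 : ContDiffAt ℝ 2 (fun t : ℝ => b * t ^ (μ - 1)) (‖x‖ ^ 2) :=
    contDiffAt_const.mul (Real.contDiffAt_rpow_const_of_ne hq0)
  have d1 : ∀ᶠ t in nhds (‖x‖ ^ 2), HasDerivAt (fun t : ℝ => t ^ μ * (α + a * Real.log t) - ε)
      (t ^ (μ - 1) * (μ * α + a + μ * a * Real.log t)) t := by
    filter_upwards [lt_mem_nhds hq] with t ht
    exact (hasDerivAt_rpow_mul_add_log μ α a ht).sub_const ε
  have d2 := hasDerivAt_rpow_mul_add_log (μ - 1) (μ * α + a) (μ * a) hq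
  have d3 : ∀ᶠ t in nhds (‖x‖ ^ 2), HasDerivAt (fun t : ℝ => b * t ^ (μ - 1))
      (b * ((μ - 1) * t ^ (μ - 1 - 1))) t := by
    filter_upwards [lt_mem_nhds hq] with t ht
    exact (Real.hasDerivAt_rpow_const (Or.inl ht.ne')).const_mul b
  have d4 : HasDerivAt (fun t : ℝ => b * ((μ - 1) * t ^ (μ - 1 - 1)))
      (b * ((μ - 1) * ((μ - 1 - 1) * (‖x‖ ^ 2) ^ (μ - 1 - 1 - 1)))) (‖x‖ ^ 2) :=
    ((Real.hasDerivAt_rpow_const (Or.inl hq0)).const_mul _).const_mul b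
  refine (lap_add (contDiffAt_coord_pow_mul_radial j 1 e1)
    (contDiffAt_coord_pow_mul_radial j 3 e2)).trans ?_
  rw [lap_coord_pow_mul_radial j 1 d1 d2, lap_coord_pow_mul_radial j 3 d3 d4,
    show μ - 2 = μ - 1 - 1 by ring, Real.rpow_sub_one hq0 (μ - 1 - 1),
    Real.rpow_sub_one hq0 (μ - 1), hN]
  norm_num
  field_simp
  ring

theorem barrier_le (j : Fin N) {α a b ε : ℝ} (hb : 0 ≤ b) {x : EuclideanSpace ℝ (Fin N)}
    (hx : 0 ≤ x j) (hx0 : x ≠ 0) :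
    barrier j α a b ε x
      ≤ x j * ((‖x‖ ^ 2) ^ (-N / 2 : ℝ) * (α + b + a * Real.log (‖x‖ ^ 2)) - ε) := by
  have hq : 0 < ‖x‖ ^ 2 := by positivity
  have hle := coord_sq_le_norm_sq j x
  have h : x j ^ 2 * (‖x‖ ^ 2) ^ (-N / 2 - 1 : ℝ) ≤ (‖x‖ ^ 2) ^ (-N / 2 : ℝ) := by
    rw [Real.rpow_sub_one hq.ne', mul_div_assoc', div_le_iff₀ hq, mul_comm]
    gcongr
  have h2 := mul_le_mul_of_nonneg_left h (mul_nonneg hx hb)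
  rw [barrier]
  nlinarith [h2]

theorem tendsto_rpow_mul_add_log {μ : ℝ} (hμ : μ < 0) (α a : ℝ) :
    Filter.Tendsto (fun R : ℝ => (R ^ 2) ^ μ * (α + a * Real.log (R ^ 2))) Filter.atTop
      (nhds 0) := by
  have h1 : Filter.Tendsto (fun t : ℝ => t ^ μ) Filter.atTop (nhds 0) := by
    simpa using tendsto_rpow_neg_atTop (neg_pos.2 hμ)
  have h2 : Filter.Tendsto (fun t : ℝ => Real.log t * t ^ μ) Filter.atTop (nhds 0) := by
    have := (isLittleO_log_rpow_atTop (neg_pos.2 hμ)).tendsto_div_nhds_zero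
    refine this.congr' ?_
    filter_upwards [Filter.eventually_gt_atTop 0] with t ht
    rw [Real.rpow_neg ht.le, div_inv_eq_mul]
  have h3 := ((h1.mul_const α).add (h2.const_mul a)).comp
    (Filter.tendsto_pow_atTop (α := ℝ) two_ne_zero)
  simp only [zero_mul, mul_zero, add_zero] at h3
  refine h3.congr fun R => ?_
  simp only [Function.comp_apply]
  ring

theorem barrier_le_of_lap_lt (hN : 0 < N) (j : Fin N) {u : EuclideanSpace ℝ (Fin N) → ℝ}
    {α a b : ℝ} (hb : 0 ≤ b)
    (hu : ∀ x : EuclideanSpace ℝ (Fin N), 0 ≤ x j → ContDiffAt ℝ 2 u x)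
    (hpos : ∀ x : EuclideanSpace ℝ (Fin N), 0 ≤ x j → 0 < u x)
    (hlap : ∀ x : EuclideanSpace ℝ (Fin N), 0 < x j → 1 < ‖x‖ →
      lap u x < x j * (‖x‖ ^ 2) ^ (-N / 2 - 1 : ℝ) * (6 * b - 2 * N * a)
        - (2 * N + 4) * b * x j ^ 3 * (‖x‖ ^ 2) ^ (-N / 2 - 2 : ℝ))
    (hinner : ∀ x : EuclideanSpace ℝ (Fin N), 0 ≤ x j → ‖x‖ = 1 → x j * α + x j ^ 3 * b ≤ u x)
    {x : EuclideanSpace ℝ (Fin N)} (hx : 0 ≤ x j) (hx1 : 1 ≤ ‖x‖) :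
    barrier j α a b 0 x ≤ u x := by
  have key : ∀ ε : ℝ, 0 < ε → barrier j α a b 0 x - ε * x j ≤ u x := by
    intro ε hε
    have hμ : (-N / 2 : ℝ) < 0 := by
      have : (0 : ℝ) < N := by exact_mod_cast hN
      linarith
    obtain ⟨R, hRε, hRx⟩ := (((tendsto_rpow_mul_add_log hμ (α + b) a).eventually_lt_const hε).and
      (Filter.eventually_ge_atTop ‖x‖)).exists
    have hne : ∀ {y : EuclideanSpace ℝ (Fin N)}, 1 ≤ ‖y‖ → y ≠ 0 := fun h =>
      norm_pos_iff.1 (one_pos.trans_le h)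
    have h : 0 ≤ u x - barrier j α a b ε x := by
      refine nonneg_of_lap_neg j (f := fun y => u y - barrier j α a b ε y) (R := R)
        (fun y hy hy1 => (hu y hy).sub (contDiffAt_barrier j α a b ε (hne hy1)))
        (fun y hy hy1 => ?_) (fun y hy hy1 => ?_) (fun y hy hyR => ?_) (fun y hy hy1 => ?_)
        hx hx1 hRx
      · rw [lap_sub (hu y hy.le) (contDiffAt_barrier j α a b ε (hne hy1.le)),
          lap_barrier j α a b ε (hne hy1.le)]
        linarith [hlap y hy hy1]
      · have := hinner y hy hy1
        simp only [barrier, hy1, one_pow, Real.one_rpow, Real.log_one]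
        nlinarith
      · have hy0 : y ≠ 0 := hne (by rw [hyR]; linarith)
        have h1 := barrier_le j (α := α) (a := a) (ε := ε) hb hy hy0
        rw [hyR] at h1
        have h2 : y j * ((R ^ 2) ^ (-N / 2 : ℝ) * (α + b + a * Real.log (R ^ 2)) - ε) ≤ 0 :=
          mul_nonpos_of_nonneg_of_nonpos hy (by linarith)
        linarith [hpos y hy]
      · have := hpos y hy.ge
        simp only [barrier, hy]
        simpa using this.le
    have he : barrier j α a b ε x = barrier j α a b 0 x - ε * x j := by
      simp only [barrier]; ring
    linarith
  refine le_of_forall_pos_le_add fun δ hδ => ?_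
  have h := key (δ / (x j + 1)) (by positivity)
  have : δ / (x j + 1) * x j ≤ δ := by
    rw [div_mul_eq_mul_div, div_le_iff₀ (by positivity)]
    nlinarith
  linarith

/-- An interior estimate: a supersolution of `-Δu = u^p` cannot be large on a large ball. -/
theorem rpow_mul_sq_le_of_supersolution_closedBall (j : Fin N)
    {u : EuclideanSpace ℝ (Fin N) → ℝ} {p R A : ℝ} (hp : 1 < p) (hR : 0 < R) (hA : 0 < A)
    {y : EuclideanSpace ℝ (Fin N)}
    (hu : ∀ x ∈ Metric.closedBall y R, ContDiffAt ℝ 2 u x)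
    (hlow : ∀ x ∈ Metric.closedBall y R, A ≤ u x)
    (hsup : ∀ x ∈ Metric.closedBall y R, u x ^ p ≤ -lap u x) :
    32 * R ^ 2 * A ^ (p - 1) ≤ (4 * N + 8) ^ 2 := by
  set w : EuclideanSpace ℝ (Fin N) → ℝ := fun x => (R ^ 2 - ‖x - y‖ ^ 2) ^ 2 with hw
  have hupos : ∀ x ∈ Metric.closedBall y R, 0 < u x := fun x hx => hA.trans_le (hlow x hx)
  have hy : y ∈ Metric.closedBall y R := Metric.mem_closedBall_self hR.le
  have hwcont : Continuous w := by fun_prop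
  obtain ⟨z, hz, hmax⟩ := (isCompact_closedBall y R).exists_isMaxOn ⟨y, hy⟩
    (f := fun x => w x / u x) (hwcont.continuousOn.div
      (fun x hx => (hu x hx).continuousAt.continuousWithinAt) fun x hx => (hupos x hx).ne')
  have huz := hupos z hz
  have hM : 0 < w z / u z := by
    refine lt_of_lt_of_le ?_ (hmax hy)
    have : w y = (R ^ 2) ^ 2 := by simp [hw]
    simp only [this]
    exact div_pos (by positivity) (hupos y hy)
  have hwz : 0 < w z := (div_pos_iff_of_pos_right huz).1 hM
  have hzR : ‖z - y‖ < R := by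
    refine lt_of_le_of_ne (by simpa [dist_eq_norm] using hz) fun h => ?_
    simp [hw, h] at hwz
  set m : ℝ := u z / w z with hm
  set F : ℝ → ℝ := fun t => m * (R ^ 2 - t) ^ 2 with hF
  have hFw : (fun x => (x + -y) j ^ 0 * F (‖x + -y‖ ^ 2)) = fun x => m * w x := by
    funext x
    simp [hF, hw, sub_eq_add_neg]
  have hd1 : ∀ t, HasDerivAt F (m * (-2 * (R ^ 2 - t))) t := fun t => by
    have := (((hasDerivAt_id t).const_sub (R ^ 2)).fun_pow 2).const_mul m
    refine this.congr_deriv ?_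
    simp
  have hd2 : ∀ t, HasDerivAt (fun t => m * (-2 * (R ^ 2 - t))) (m * 2) t := fun t => by
    have := (((hasDerivAt_id t).const_sub (R ^ 2)).const_mul (-2)).const_mul m
    refine this.congr_deriv ?_
    simp
  have hlapw : lap (fun x => m * w x) z
      = m * (8 * R ^ 2 - (4 * N + 8) * (R ^ 2 - ‖z - y‖ ^ 2)) := by
    rw [← hFw, lap_comp_add_right (fun x => x j ^ 0 * F (‖x‖ ^ 2)) (-y) z,
      lap_coord_pow_mul_radial j 0 (Filter.Eventually.of_forall hd1) (hd2 _), ← sub_eq_add_neg]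
    simp
    ring
  have hwC : ContDiffAt ℝ 2 (fun x => m * w x) z :=
    contDiffAt_const.mul ((contDiffAt_const.sub
      ((contDiff_norm_sq ℝ).contDiffAt.comp z (contDiffAt_id.sub contDiffAt_const))).pow 2)
  have hloc : IsLocalMin (fun x => u x - m * w x) z := by
    filter_upwards [Metric.closedBall_mem_nhds_of_mem (mem_ball_iff_norm.2 hzR)] with x hx
    have h1 : w x / u x ≤ w z / u z := hmax hx
    rw [div_le_div_iff₀ (hupos x hx) huz] at h1
    have h2 : m * w x ≤ u x := by
      rw [hm, div_mul_eq_mul_div, div_le_iff₀ hwz]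
      linarith
    have h3 : m * w z = u z := div_mul_cancel₀ _ hwz.ne'
    linarith
  have hnn := lap_nonneg_of_isLocalMin ((hu z hz).sub hwC) hloc
  rw [lap_sub (hu z hz) hwC, hlapw] at hnn
  have hs := hsup z hz
  have hpow : u z ^ p = u z ^ (p - 1) * u z := by
    rw [← Real.rpow_add_one huz.ne']; ring_nf
  have hAu : A ^ (p - 1) ≤ u z ^ (p - 1) :=
    Real.rpow_le_rpow hA.le (hlow z hz) (by linarith)
  have hX : 0 < A ^ (p - 1) := Real.rpow_pos_of_pos hA _
  set X := A ^ (p - 1)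
  set D := R ^ 2 - ‖z - y‖ ^ 2 with hD
  have hwD : w z = D ^ 2 := rfl
  have h4 : u z * X ≤ u z / D ^ 2 * ((4 * N + 8) * D - 8 * R ^ 2) := by
    have := mul_le_mul_of_nonneg_left hAu huz.le
    rw [← hwD, ← hm]
    linarith
  have h5 : X * D ^ 2 ≤ (4 * N + 8) * D - 8 * R ^ 2 := by
    rw [hwD] at hwz
    rw [div_mul_eq_mul_div, le_div_iff₀ hwz, mul_assoc] at h4
    exact le_of_mul_le_mul_left h4 huz
  nlinarith [sq_nonneg (2 * X * D - (4 * N + 8)), mul_le_mul_of_nonneg_left h5 hX.le]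

theorem pow_three_mul_rpow_le {p ℓ q : ℝ} (hN : 2 ≤ N) (hp2 : p ≤ ((N : ℝ) + 1) / ((N : ℝ) - 1))
    (hℓ : 0 < ℓ) (hq : 1 ≤ q) (hℓq : ℓ ^ 2 ≤ q) :
    ℓ ^ 3 * q ^ (-N / 2 - 2 : ℝ) ≤ (ℓ * q ^ (-N / 2 : ℝ)) ^ p := by
  have hq0 : 0 < q := by linarith
  have hN' : (2 : ℝ) ≤ N := by exact_mod_cast hN
  rw [le_div_iff₀ (by linarith)] at hp2
  have hp3 : p ≤ 3 := by nlinarith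
  have h1 : ℓ ^ (3 - p) ≤ q ^ ((3 - p) / 2) := by
    have : ℓ ^ (3 - p) = (ℓ ^ 2) ^ ((3 - p) / 2) := by
      rw [← Real.rpow_natCast ℓ 2, ← Real.rpow_mul hℓ.le]
      congr 1; push_cast; ring
    rw [this]
    exact Real.rpow_le_rpow (by positivity) hℓq (by linarith)
  have h2 : ℓ ^ 3 = ℓ ^ p * ℓ ^ (3 - p) := by
    rw [← Real.rpow_add hℓ, ← Real.rpow_natCast]; congr 1; push_cast; ring
  rw [Real.mul_rpow hℓ.le (by positivity), ← Real.rpow_mul hq0.le, h2, mul_assoc]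
  gcongr
  calc ℓ ^ (3 - p) * q ^ (-N / 2 - 2 : ℝ) ≤ q ^ ((3 - p) / 2) * q ^ (-N / 2 - 2 : ℝ) := by gcongr
    _ = q ^ ((3 - p) / 2 + (-N / 2 - 2)) := (Real.rpow_add hq0 _ _).symm
    _ ≤ q ^ (-N / 2 * p) := Real.rpow_le_rpow_of_exponent_le hq (by nlinarith)

theorem exists_log_lower_bound (hN : 2 ≤ N) (j : Fin N) {p : ℝ} (hp1 : 1 < p)
    (hp2 : p ≤ ((N : ℝ) + 1) / ((N : ℝ) - 1)) {u : EuclideanSpace ℝ (Fin N) → ℝ}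
    (hu : ∀ x : EuclideanSpace ℝ (Fin N), 0 ≤ x j → ContDiffAt ℝ 2 u x)
    (hpos : ∀ x : EuclideanSpace ℝ (Fin N), 0 ≤ x j → 0 < u x)
    (hsup : ∀ x : EuclideanSpace ℝ (Fin N), 0 ≤ x j → u x ^ p ≤ -lap u x) :
    ∃ κ : ℝ, 0 < κ ∧ ∀ x : EuclideanSpace ℝ (Fin N), 0 ≤ x j → 1 ≤ ‖x‖ →
      κ * (x j * (‖x‖ ^ 2) ^ (-N / 2 : ℝ) * (3 * Real.log (‖x‖ ^ 2) - N)) ≤ u x := by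
  have hN0 : 0 < N := by omega
  have hNr : (0 : ℝ) < N := by exact_mod_cast hN0
  have hcompact : IsCompact (Metric.sphere (0 : EuclideanSpace ℝ (Fin N)) 1 ∩ {x | 0 ≤ x j}) :=
    (isCompact_sphere _ _).inter_right (isClosed_coord_nonneg j)
  obtain ⟨z, hz, hmin⟩ := hcompact.exists_isMinOn
    ⟨EuclideanSpace.single j 1, by simp, by simp⟩
    fun x hx => (hu x hx.2).continuousAt.continuousWithinAt
  set c := u z
  have hc : 0 < c := hpos z hz.2
  have hfirst : ∀ x : EuclideanSpace ℝ (Fin N), 0 ≤ x j → 1 ≤ ‖x‖ →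
      x j * (‖x‖ ^ 2) ^ (-N / 2 : ℝ) * c ≤ u x := by
    intro x hx hx1
    have := barrier_le_of_lap_lt hN0 j (α := c) (a := 0) (b := 0) le_rfl hu hpos
      (fun y hy _ => ?_) (fun y hy hy1 => ?_) hx hx1
    · simp only [barrier] at this
      linarith
    · have := hsup y hy.le
      have := Real.rpow_pos_of_pos (hpos y hy.le) p
      simp only [mul_zero, zero_mul, sub_zero]
      linarith
    · have h1 : c ≤ u y := hmin ⟨by simpa using hy1, hy⟩
      have h2 := coord_sq_le_norm_sq j y
      rw [hy1] at h2
      nlinarith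
  set κ := c ^ p / (2 * (N * (2 * N + 4))) with hκ
  have hcp : 0 < c ^ p := Real.rpow_pos_of_pos hc p
  have hκ0 : 0 < κ := by positivity
  refine ⟨κ, hκ0, fun x hx hx1 => ?_⟩
  have := barrier_le_of_lap_lt hN0 j (α := -(N * κ)) (a := 3 * κ) (b := N * κ) (by positivity)
      hu hpos (fun y hy hy1 => ?_) (fun y hy hy1 => ?_) hx hx1
  · simp only [barrier] at this
    have h2 : 0 ≤ x j ^ 3 * (N * κ * (‖x‖ ^ 2) ^ (-N / 2 - 1 : ℝ)) := by positivity
    linarith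
  · have hq : (1 : ℝ) ≤ ‖y‖ ^ 2 := one_le_pow₀ hy1.le
    have h1 := pow_three_mul_rpow_le hN hp2 hy hq (coord_sq_le_norm_sq j y)
    have h2 := Real.rpow_le_rpow (by positivity) (hfirst y hy.le hy1.le)
      (by linarith : (0 : ℝ) ≤ p)
    rw [Real.mul_rpow (by positivity) hc.le] at h2
    have h3 := hsup y hy.le
    have h4 : (2 * N + 4) * (N * κ) = c ^ p / 2 := by
      rw [hκ]; field_simp
    have h5 : 0 < y j ^ 3 * (‖y‖ ^ 2) ^ (-N / 2 - 2 : ℝ) := by positivity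
    have h6 : (2 * N + 4) * (N * κ) * y j ^ 3 * (‖y‖ ^ 2) ^ (-N / 2 - 2 : ℝ)
        = c ^ p / 2 * (y j ^ 3 * (‖y‖ ^ 2) ^ (-N / 2 - 2 : ℝ)) := by rw [h4]; ring
    rw [h6]
    nlinarith [mul_le_mul_of_nonneg_right h1 hcp.le, mul_pos hcp h5]
  · have h2 := coord_sq_le_norm_sq j y
    rw [hy1] at h2
    have h3 : y j ^ 3 ≤ y j := by nlinarith
    have h4 := mul_le_mul_of_nonneg_right h3 (by positivity : 0 ≤ N * κ)
    linarith [hpos y hy]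

theorem no_positive_supersolution_closed_halfspace (hN : 2 ≤ N) (j : Fin N) {p : ℝ} (hp1 : 1 < p)
    (hp2 : p ≤ ((N : ℝ) + 1) / ((N : ℝ) - 1)) {u : EuclideanSpace ℝ (Fin N) → ℝ}
    (hu : ∀ x : EuclideanSpace ℝ (Fin N), 0 ≤ x j → ContDiffAt ℝ 2 u x)
    (hpos : ∀ x : EuclideanSpace ℝ (Fin N), 0 ≤ x j → 0 < u x)
    (hsup : ∀ x : EuclideanSpace ℝ (Fin N), 0 ≤ x j → u x ^ p ≤ -lap u x) : False := by
  obtain ⟨κ, hκ, hlow⟩ := exists_log_lower_bound hN j hp1 hp2 hu hpos hsup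
  have hN' : (2 : ℝ) ≤ N := by exact_mod_cast hN
  have hlim : Filter.Tendsto (fun R : ℝ => (κ * 9 ^ (-N / 2 : ℝ) * (6 * Real.log R - N)) ^ (p - 1))
      Filter.atTop Filter.atTop := by
    refine (tendsto_rpow_atTop (by linarith)).comp
      (Filter.Tendsto.const_mul_atTop (by positivity) ?_)
    exact Filter.tendsto_atTop_add_const_right _ _
      (Real.tendsto_log_atTop.const_mul_atTop (by norm_num))
  obtain ⟨R, hRbig, hR1, hRlog⟩ := ((hlim.eventually_gt_atTop ((4 * N + 8) ^ 2)).and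
    ((Filter.eventually_ge_atTop (1 : ℝ)).and
      (Real.tendsto_log_atTop.eventually_gt_atTop (N : ℝ)))).exists
  have hR0 : 0 < R := by linarith
  set B := κ * 9 ^ (-N / 2 : ℝ) * (6 * Real.log R - N) with hB
  have hB0 : 0 < B := mul_pos (by positivity) (by linarith)
  set y : EuclideanSpace ℝ (Fin N) := EuclideanSpace.single j (2 * R) with hy
  have hball : ∀ x ∈ Metric.closedBall y R, R ≤ x j ∧ R ≤ ‖x‖ ∧ ‖x‖ ≤ 3 * R := by
    intro x hx
    have hxy : ‖x - y‖ ≤ R := mem_closedBall_iff_norm.1 hx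
    have hyn : ‖y‖ = 2 * R := by
      rw [hy, PiLp.norm_single, Real.norm_of_nonneg (by linarith)]
    have h1 := (PiLp.norm_apply_le (x - y) j).trans hxy
    have h2 := PiLp.norm_apply_le x j
    rw [Real.norm_eq_abs] at h1 h2
    have h3 : (x - y) j = x j - 2 * R := by simp [hy]
    rw [h3, abs_le] at h1
    refine ⟨by linarith, by linarith [le_abs_self (x j)], ?_⟩
    have := norm_add_le (x - y) y
    rw [sub_add_cancel] at this
    linarith
  have hxj : ∀ x ∈ Metric.closedBall y R, 0 ≤ x j := fun x hx => hR0.le.trans (hball x hx).1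
  have hest := rpow_mul_sq_le_of_supersolution_closedBall (A := R ^ (1 - N : ℝ) * B) j hp1 hR0
    (by positivity) (fun x hx => hu x (hxj x hx)) (fun x hx => ?_) (fun x hx => hsup x (hxj x hx))
  · rw [Real.mul_rpow (by positivity) hB0.le, ← Real.rpow_mul hR0.le] at hest
    have h1 : 1 ≤ R ^ 2 * R ^ ((1 - N) * (p - 1) : ℝ) := by
      rw [← Real.rpow_natCast R 2, ← Real.rpow_add hR0]
      refine Real.one_le_rpow hR1 ?_
      rw [le_div_iff₀ (by linarith)] at hp2
      push_cast
      linarith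
    have hBp : 0 < B ^ (p - 1) := Real.rpow_pos_of_pos hB0 _
    nlinarith [mul_le_mul_of_nonneg_right h1 hBp.le]
  · obtain ⟨h1, h2, h3⟩ := hball x hx
    have hx0 : 0 < ‖x‖ := by linarith
    refine le_trans ?_ (hlow x (hxj x hx) (hR1.trans h2))
    have hlog : 2 * Real.log R ≤ Real.log (‖x‖ ^ 2) := by
      rw [Real.log_pow]; push_cast
      linarith [Real.log_le_log hR0 h2]
    have hrad : 9 ^ (-N / 2 : ℝ) * R ^ (-N : ℝ) ≤ (‖x‖ ^ 2) ^ (-N / 2 : ℝ) := by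
      have : (9 : ℝ) ^ (-N / 2 : ℝ) * R ^ (-N : ℝ) = (9 * R ^ 2) ^ (-N / 2 : ℝ) := by
        rw [Real.mul_rpow (by norm_num) (by positivity), ← Real.rpow_natCast R 2,
          ← Real.rpow_mul hR0.le]
        congr 2; push_cast; ring
      rw [this]
      exact Real.rpow_le_rpow_of_nonpos (by positivity) (by nlinarith) (by linarith)
    have hR : R ^ (1 - N : ℝ) = R * R ^ (-N : ℝ) := by
      rw [sub_eq_add_neg, Real.rpow_add hR0, Real.rpow_one]
    calc R ^ (1 - N : ℝ) * B
        = κ * (R * (9 ^ (-N / 2 : ℝ) * R ^ (-N : ℝ)) * (6 * Real.log R - N)) := by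
          rw [hR, hB]; ring
      _ ≤ κ * (x j * (‖x‖ ^ 2) ^ (-N / 2 : ℝ) * (3 * Real.log (‖x‖ ^ 2) - N)) := by
          have : 0 ≤ 6 * Real.log R - N := by linarith
          have := hxj x hx
          have hl : 6 * Real.log R - N ≤ 3 * Real.log (‖x‖ ^ 2) - N := by linarith
          gcongr κ * (?_ * ?_ * ?_)

end HalfSpace

/-- For `N ≥ 3`, `ρ > 0` and `1 < p ≤ (N+1)/(N-1)` there is no positive classical
supersolution of `-Δu = u^p` on `C₊ ∩ {‖x‖ > ρ}`, where `C₊ = {x_N > 0}`. -/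
theorem no_positive_supersolution_halfspace
    (N : ℕ) (hN : 3 ≤ N) (ρ : ℝ) (hρ : 0 < ρ) (p : ℝ)
    (hp1 : 1 < p) (hp2 : p ≤ ((N : ℝ) + 1) / ((N : ℝ) - 1)) :
    ¬ ∃ u : EuclideanSpace ℝ (Fin N) → ℝ,
        ContDiffOn ℝ 2 u {x | 0 < lastCoord x ∧ ρ < ‖x‖} ∧
        (∀ x : EuclideanSpace ℝ (Fin N), 0 < lastCoord x → ρ < ‖x‖ → 0 < u x) ∧
        (∀ x : EuclideanSpace ℝ (Fin N), 0 < lastCoord x → ρ < ‖x‖ → -lap u x ≥ u x ^ p) := by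
  rintro ⟨u, hC, hpos, hsup⟩
  have hN0 : 0 < N := by omega
  set j : Fin N := ⟨N - 1, Nat.sub_lt hN0 Nat.one_pos⟩ with hj
  have hlast : ∀ x : EuclideanSpace ℝ (Fin N), lastCoord x = x j := fun x => dif_pos hN0
  set a : EuclideanSpace ℝ (Fin N) := EuclideanSpace.single j (2 * ρ) with ha
  have hmem : ∀ x : EuclideanSpace ℝ (Fin N), 0 ≤ x j →
      0 < lastCoord (x + a) ∧ ρ < ‖x + a‖ := by
    intro x hx
    have h1 : (x + a) j = x j + 2 * ρ := by simp [ha]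
    have h2 := PiLp.norm_apply_le (x + a) j
    rw [Real.norm_eq_abs] at h2
    refine ⟨by rw [hlast]; linarith, ?_⟩
    linarith [le_abs_self ((x + a) j)]
  have hopen : IsOpen {x : EuclideanSpace ℝ (Fin N) | 0 < lastCoord x ∧ ρ < ‖x‖} := by
    simp only [hlast]
    exact (isOpen_lt continuous_const
      (EuclideanSpace.proj j : EuclideanSpace ℝ (Fin N) →L[ℝ] ℝ).continuous).inter
      (isOpen_lt continuous_const continuous_norm)
  refine no_positive_supersolution_closed_halfspace (u := fun x => u (x + a)) (by omega) j hp1 hp2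
    (fun x hx => ?_) (fun x hx => hpos _ (hmem x hx).1 (hmem x hx).2) (fun x hx => ?_)
  · exact ContDiffAt.comp x (hC.contDiffAt (hopen.mem_nhds (hmem x hx)))
      (contDiffAt_id.add contDiffAt_const)
  · rw [lap_comp_add_right]
    exact hsup _ (hmem x hx).1 (hmem x hx).2
end

section
/- Let N ≥ 3 and p > (N+1)/(N-1). Set β := 2/(p-1) + 1. Then 1 < β < N, and for every ε > 0 with ε^{p-1} ≤ β(N-β), the function u(x) := ε·x_N·‖x‖^{-β} is C² and positive on C₊, and satisfies -Δu(x) = ε·β(N-β)·x_N·‖x‖^{-β-2} ≥ u(x)^p > 0 for every x ∈ C₊. In particular, for every p > (N+1)/(N-1) the equation -Δu = u^p has a positive classical supersolution on the half-space cone C₊. (Sharpness of the exponent (N+1)/(N-1) in Theorem 1.3 for the upper hemisphere.) -/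
theorem hasFDerivAt_norm_rpow_of_ne_zero {E : Type*} [NormedAddCommGroup E]
    [InnerProductSpace ℝ E] (a : ℝ) {x : E} (hx : x ≠ 0) :
    HasFDerivAt (fun y : E => ‖y‖ ^ a) ((a * ‖x‖ ^ (a - 2)) • innerSL ℝ x) x := by
  have hpow (b : ℝ) (y : E) : (‖y‖ ^ 2) ^ (b / 2) = ‖y‖ ^ b := by
    rw [← Real.rpow_natCast, ← Real.rpow_mul (norm_nonneg y)]
    congr 1
    push_cast
    ring
  have hd := ((hasStrictFDerivAt_norm_sq x).hasFDerivAt).rpow_const (p := a / 2)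
    (Or.inl (pow_ne_zero 2 (norm_ne_zero_iff.mpr hx)))
  simp only [hpow] at hd
  convert hd using 1
  rw [show a / 2 - 1 = (a - 2) / 2 by ring, hpow]
  ext v
  simp
  ring

theorem hasFDerivAt_clm_mul_norm_rpow {E : Type*} [NormedAddCommGroup E]
    [InnerProductSpace ℝ E] (L : E →L[ℝ] ℝ) (a : ℝ) {x : E} (hx : x ≠ 0) :
    HasFDerivAt (fun y : E => L y * ‖y‖ ^ a)
      (L x • ((a * ‖x‖ ^ (a - 2)) • innerSL ℝ x) + ‖x‖ ^ a • L) x :=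
  L.hasFDerivAt.mul (hasFDerivAt_norm_rpow_of_ne_zero a hx)

theorem fderiv_fderiv_clm_mul_norm_rpow {E : Type*} [NormedAddCommGroup E]
    [InnerProductSpace ℝ E] (L : E →L[ℝ] ℝ) (a : ℝ) {x : E} (hx : x ≠ 0) (v : E) :
    fderiv ℝ (fun y => fderiv ℝ (fun z : E => L z * ‖z‖ ^ a) y v) x v =
      2 * a * ‖x‖ ^ (a - 2) * (L v * inner ℝ x v)
        + a * (a - 2) * L x * ‖x‖ ^ (a - 4) * inner ℝ x v ^ 2
        + a * L x * ‖x‖ ^ (a - 2) * ‖v‖ ^ 2 := by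
  have hev : (fun y => fderiv ℝ (fun z : E => L z * ‖z‖ ^ a) y v) =ᶠ[nhds x]
      fun y => a * ((L y * ‖y‖ ^ (a - 2)) * innerSL ℝ v y) + ‖y‖ ^ a * L v := by
    filter_upwards [isOpen_ne.mem_nhds hx] with y hy
    rw [(hasFDerivAt_clm_mul_norm_rpow L a hy).fderiv]
    simp [real_inner_comm]
    ring
  have hd := ((((hasFDerivAt_clm_mul_norm_rpow L (a - 2) hx).mul
    (innerSL ℝ v).hasFDerivAt).const_mul a).add
    ((hasFDerivAt_norm_rpow_of_ne_zero a hx).mul_const (L v)))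
  rw [hev.fderiv_eq]
  refine (congrArg (fun f : E →L[ℝ] ℝ => f v) hd.fderiv).trans ?_
  simp [real_inner_comm x v, show a - 2 - 2 = a - 4 by ring]
  ring

theorem lap_clm_mul_norm_rpow {N : ℕ} (L : EuclideanSpace ℝ (Fin N) →L[ℝ] ℝ) (a : ℝ)
    {x : EuclideanSpace ℝ (Fin N)} (hx : x ≠ 0) :
    lap (fun y => L y * ‖y‖ ^ a) x = a * (a + N) * L x * ‖x‖ ^ (a - 2) := by
  have hL : ∑ i, L (EuclideanSpace.single i 1) * x i = L x := by
    conv_rhs => rw [← (EuclideanSpace.basisFun (Fin N) ℝ).sum_repr x]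
    simp [mul_comm]
  have hsq : ∑ i, x i ^ 2 = ‖x‖ ^ 2 := (EuclideanSpace.real_norm_sq_eq x).symm
  have hpow : ‖x‖ ^ (a - 4) * ‖x‖ ^ 2 = ‖x‖ ^ (a - 2) := by
    rw [← Real.rpow_natCast, ← Real.rpow_add (norm_pos_iff.mpr hx)]
    congr 1
    push_cast
    ring
  simp only [lap, fderiv_fderiv_clm_mul_norm_rpow L a hx, Finset.sum_add_distrib,
    EuclideanSpace.inner_single_right, PiLp.norm_single, ← Finset.mul_sum]
  simp only [one_mul, conj_trivial, hL, hsq, norm_one, one_pow, Finset.sum_const,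
    Finset.card_univ, Fintype.card_fin, nsmul_eq_mul, mul_one]
  linear_combination a * (a - 2) * L x * hpow

theorem lastCoord_eq {N : ℕ} (hN : 0 < N) (x : EuclideanSpace ℝ (Fin N)) :
    lastCoord x = x ⟨N - 1, Nat.sub_lt hN Nat.one_pos⟩ := by
  simp [lastCoord, hN]

theorem lastCoord_le_norm {N : ℕ} (x : EuclideanSpace ℝ (Fin N)) : lastCoord x ≤ ‖x‖ := by
  unfold lastCoord
  split_ifs
  · exact (le_abs_self _).trans (PiLp.norm_apply_le x _)
  · exact norm_nonneg x

/-- For `N ≥ 3` and `p > (N+1)/(N-1)`, with `β = 2/(p-1) + 1` one has `1 < β < N`, and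
for every `ε > 0` with `ε^(p-1) ≤ β(N-β)` the function `u(x) = ε x_N ‖x‖^{-β}` is a
positive classical supersolution of `-Δu = u^p` on the half-space cone `C₊ = {x_N > 0}`,
with `-Δu = ε β(N-β) x_N ‖x‖^{-β-2} ≥ u^p > 0` there. -/
theorem halfspace_supersolution_supercritical
    (N : ℕ) (hN : 3 ≤ N) (p : ℝ) (hp : ((N : ℝ) + 1) / ((N : ℝ) - 1) < p)
    (β : ℝ) (hβ : β = 2 / (p - 1) + 1) :
    (1 < β ∧ β < (N : ℝ)) ∧
    ∀ ε : ℝ, 0 < ε → ε ^ (p - 1) ≤ β * ((N : ℝ) - β) →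
      ContDiffOn ℝ 2 (fun x : EuclideanSpace ℝ (Fin N) => ε * lastCoord x * ‖x‖ ^ (-β))
        {x | 0 < lastCoord x} ∧
      (∀ x : EuclideanSpace ℝ (Fin N), 0 < lastCoord x →
        0 < ε * lastCoord x * ‖x‖ ^ (-β)) ∧
      (∀ x : EuclideanSpace ℝ (Fin N), 0 < lastCoord x →
        -lap (fun y : EuclideanSpace ℝ (Fin N) => ε * lastCoord y * ‖y‖ ^ (-β)) x
            = ε * (β * ((N : ℝ) - β)) * lastCoord x * ‖x‖ ^ (-β - 2) ∧
        (ε * lastCoord x * ‖x‖ ^ (-β)) ^ p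
            ≤ ε * (β * ((N : ℝ) - β)) * lastCoord x * ‖x‖ ^ (-β - 2) ∧
        0 < (ε * lastCoord x * ‖x‖ ^ (-β)) ^ p) := by
  have hN' : (3 : ℝ) ≤ N := by exact_mod_cast hN
  have hN0 : 0 < N := by omega
  have hp2 : 2 / ((N : ℝ) - 1) < p - 1 := by
    have : ((N : ℝ) + 1) / (N - 1) = 2 / ((N : ℝ) - 1) + 1 := by
      field_simp [show (N : ℝ) - 1 ≠ 0 by linarith]
      ring
    linarith
  have hp1 : 0 < p - 1 := lt_trans (div_pos two_pos (by linarith)) hp2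
  have hβ1 : 1 < β := by
    have := div_pos two_pos hp1
    linarith
  have hβN : β < N := by
    have : 2 / (p - 1) < (N : ℝ) - 1 := (div_lt_comm₀ (by linarith) hp1).mp hp2
    linarith
  refine ⟨⟨hβ1, hβN⟩, fun ε hε hεβ => ?_⟩
  have hnorm {x : EuclideanSpace ℝ (Fin N)} (hx : 0 < lastCoord x) : 0 < ‖x‖ :=
    hx.trans_le (lastCoord_le_norm x)
  have hpos (x : EuclideanSpace ℝ (Fin N)) (hx : 0 < lastCoord x) :
      0 < ε * lastCoord x * ‖x‖ ^ (-β) :=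
    mul_pos (mul_pos hε hx) (Real.rpow_pos_of_pos (hnorm hx) _)
  let L : EuclideanSpace ℝ (Fin N) →L[ℝ] ℝ :=
    ε • EuclideanSpace.proj ⟨N - 1, Nat.sub_lt hN0 Nat.one_pos⟩
  have hL (x : EuclideanSpace ℝ (Fin N)) : ε * lastCoord x = L x := by
    simp [L, lastCoord_eq hN0]
  refine ⟨?_, hpos, fun x hx => ⟨?_, ?_, Real.rpow_pos_of_pos (hpos x hx) p⟩⟩
  · simp only [hL]
    intro x hx
    have hx0 : x ≠ 0 := norm_pos_iff.mp (hnorm hx)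
    exact (L.contDiff.contDiffAt.mul ((contDiffAt_norm ℝ hx0).rpow_const_of_ne
      (norm_ne_zero_iff.mpr hx0))).contDiffWithinAt
  · simp only [hL, lap_clm_mul_norm_rpow L (-β) (norm_pos_iff.mp (hnorm hx))]
    rw [← hL]
    ring
  · have hr := hnorm hx
    have hβp : β * (p - 1) = p + 1 := by
      rw [hβ]
      field_simp
      ring
    have hsplit : (ε * lastCoord x * ‖x‖ ^ (-β)) ^ p =
        (ε ^ (p - 1) * lastCoord x ^ (p - 1)) * (ε * lastCoord x * ‖x‖ ^ (-β * p)) := by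
      rw [Real.mul_rpow (mul_pos hε hx).le (Real.rpow_nonneg hr.le _),
        Real.mul_rpow hε.le hx.le, ← Real.rpow_mul hr.le,
        Real.rpow_sub_one hε.ne', Real.rpow_sub_one hx.ne']
      field_simp
    have hexp : ‖x‖ ^ (p - 1) * ‖x‖ ^ (-β * p) = ‖x‖ ^ (-β - 2) := by
      rw [← Real.rpow_add hr]
      congr 1
      linear_combination -hβp
    calc (ε * lastCoord x * ‖x‖ ^ (-β)) ^ p
        = (ε ^ (p - 1) * lastCoord x ^ (p - 1)) * (ε * lastCoord x * ‖x‖ ^ (-β * p)) := hsplit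
      _ ≤ (β * (N - β) * ‖x‖ ^ (p - 1)) * (ε * lastCoord x * ‖x‖ ^ (-β * p)) := by
          have hle := Real.rpow_le_rpow hx.le (lastCoord_le_norm x) hp1.le
          have hnn : 0 ≤ β * ((N : ℝ) - β) := mul_nonneg (by linarith) (by linarith)
          gcongr
      _ = ε * (β * (N - β)) * lastCoord x * ‖x‖ ^ (-β - 2) := by
          rw [← hexp]
          ring
end

section
/- Let N ≥ 1, let K be a nonempty cone in ℝ^N, let ρ > 0 and C_S ∈ (0,1), and let v : ℝ^N → ℝ be positive on K ∩ {x : ‖x‖ > ρ}. Assume the following Harnack-type hypothesis: for every r ≥ 2ρ and all x, y ∈ K with 3r/4 ≤ ‖x‖ ≤ 7r/2 and 3r/4 ≤ ‖y‖ ≤ 7r/2, one has v(x) ≥ C_S·v(y). Set α := log C_S / log 2 (so α < 0). Then there exists c > 0 such that v(x) ≥ c·‖x‖^α for every x ∈ K with ‖x‖ ≥ 3ρ/2. (The paper's Lemma 5.1: iteration of the Harnack inequality along dyadic annuli yields a polynomial lower bound for positive solutions on cone-like domains.) -/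
open scoped Pointwise

/-- Iterating the Harnack inequality along dyadic annuli yields a polynomial lower bound
for positive functions on cone-like domains (the paper's Lemma 5.1). -/
theorem harnack_iteration_polynomial_lower_bound
    (N : ℕ) (hN : 1 ≤ N)
    (K : Set (EuclideanSpace ℝ (Fin N))) (hKopen : IsOpen K)
    (hK0 : K ⊆ {x | x ≠ 0}) (hKcone : ∀ t : ℝ, 0 < t → t • K = K) (hKne : K.Nonempty)
    (ρ CS : ℝ) (hρ : 0 < ρ) (hCS : CS ∈ Set.Ioo (0 : ℝ) 1)
    (v : EuclideanSpace ℝ (Fin N) → ℝ)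
    (hvpos : ∀ x ∈ K, ρ < ‖x‖ → 0 < v x)
    (hharnack : ∀ r : ℝ, 2 * ρ ≤ r → ∀ x ∈ K, ∀ y ∈ K,
      3 * r / 4 ≤ ‖x‖ → ‖x‖ ≤ 7 * r / 2 → 3 * r / 4 ≤ ‖y‖ → ‖y‖ ≤ 7 * r / 2 →
      v x ≥ CS * v y)
    (α : ℝ) (hα : α = Real.log CS / Real.log 2) :
    α < 0 ∧ ∃ c > (0 : ℝ), ∀ x ∈ K, 3 * ρ / 2 ≤ ‖x‖ → v x ≥ c * ‖x‖ ^ α := by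
  have hlog2 : 0 < Real.log 2 := Real.log_pos one_lt_two
  have hαneg : α < 0 := hα ▸ div_neg_of_neg_of_pos (Real.log_neg hCS.1 hCS.2) hlog2
  have htwo : (2 : ℝ) ^ α = CS := by
    rw [Real.rpow_def_of_pos two_pos, hα, mul_div_cancel₀ _ hlog2.ne', Real.exp_log hCS.1]
  have hsmul : ∀ t : ℝ, 0 < t → ∀ x ∈ K, t • x ∈ K := fun t ht x hx => by
    rw [← hKcone t ht]
    exact Set.smul_mem_smul_set hx
  refine ⟨hαneg, ?_⟩
  obtain ⟨e, he⟩ := hKne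
  have hepos : 0 < ‖e‖ := norm_pos_iff.2 (hK0 he)
  obtain ⟨y, hy, hynorm⟩ : ∃ y ∈ K, ‖y‖ = 2 * ρ := by
    refine ⟨(2 * ρ / ‖e‖) • e, hsmul _ (by positivity) e he, ?_⟩
    rw [norm_smul, Real.norm_of_nonneg (by positivity), div_mul_cancel₀ _ hepos.ne']
  have hvy : 0 < v y := hvpos y hy (by linarith)
  have hpow : 0 < (3 * ρ / 2) ^ α := Real.rpow_pos_of_pos (by positivity) α
  have hbase : ∀ x ∈ K, 3 * ρ / 2 ≤ ‖x‖ → ‖x‖ ≤ 4 * ρ →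
      CS * v y / (3 * ρ / 2) ^ α * ‖x‖ ^ α ≤ v x := fun x hx hlow hup => by
    have hrpow : ‖x‖ ^ α ≤ (3 * ρ / 2) ^ α :=
      Real.rpow_le_rpow_of_nonpos (by positivity) hlow hαneg.le
    calc CS * v y / (3 * ρ / 2) ^ α * ‖x‖ ^ α
        ≤ CS * v y / (3 * ρ / 2) ^ α * (3 * ρ / 2) ^ α :=
          mul_le_mul_of_nonneg_left hrpow (div_pos (mul_pos hCS.1 hvy) hpow).le
      _ = CS * v y := div_mul_cancel₀ _ hpow.ne'
      _ ≤ v x := hharnack (2 * ρ) le_rfl x hx y hy (by linarith) (by linarith)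
          (by linarith) (by linarith)
  refine ⟨CS * v y / (3 * ρ / 2) ^ α, div_pos (mul_pos hCS.1 hvy) hpow, ?_⟩
  generalize CS * v y / (3 * ρ / 2) ^ α = c at hbase ⊢
  have hdyadic : ∀ n : ℕ, ∀ x ∈ K, 3 * ρ / 2 ≤ ‖x‖ → ‖x‖ ≤ 4 * ρ * 2 ^ n →
      c * ‖x‖ ^ α ≤ v x := by
    intro n
    induction n with
    | zero => simpa using hbase
    | succ n ih =>
      intro x hx hlow hup
      rcases le_total ‖x‖ (4 * ρ) with hsmall | hlarge
      · exact hbase x hx hlow hsmall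
      have hhalf : ‖(1 / 2 : ℝ) • x‖ = ‖x‖ / 2 := by
        rw [norm_smul, Real.norm_of_nonneg (by norm_num)]
        ring
      have hmem := hsmul (1 / 2) (by norm_num) x hx
      have hprev := ih _ hmem (by rw [hhalf]; linarith)
        (by rw [hhalf]; rw [pow_succ] at hup; linarith)
      rw [hhalf, Real.div_rpow (norm_nonneg x) zero_le_two, htwo] at hprev
      calc c * ‖x‖ ^ α = CS * (c * (‖x‖ ^ α / CS)) := by
            have := hCS.1.ne'
            field_simp
        _ ≤ CS * v ((1 / 2 : ℝ) • x) := mul_le_mul_of_nonneg_left hprev hCS.1.le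
        _ ≤ v x := hharnack (‖x‖ / 2) (by linarith) x hx _ hmem (by linarith) (by linarith)
            (by rw [hhalf]; linarith) (by rw [hhalf]; linarith)
  intro x hx hlow
  obtain ⟨n, hn⟩ := pow_unbounded_of_one_lt (‖x‖ / (4 * ρ)) one_lt_two
  refine hdyadic n x hx hlow ?_
  rw [div_lt_iff₀ (by positivity)] at hn
  linarith
end

section
/- Let N ≥ 3, let U ⊆ ℝ^N be open, let 1 < p₀ < p, and set α := (p-1)/(p₀-1) (so α > 1). Let u : ℝ^N → ℝ be C² on U, positive on U, and satisfy -Δu(x) ≥ u(x)^{p₀} for all x ∈ U. Then the function v := α^{-1/(p-1)}·u^{1/α} is C² and positive on U and satisfies -Δv(x) ≥ v(x)^p for all x ∈ U. (Classical core of the paper's Proposition 1.1(ii): a positive supersolution for exponent p₀ yields, after the power transformation u ↦ α^{1/(1-p)}u^{1/α}, a positive supersolution for every larger exponent p.) -/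
open Filter Topology in
/-- Chain rule for the Laplacian of a power of a positive function. -/
theorem lap_const_mul_rpow {N : ℕ} {u : EuclideanSpace ℝ (Fin N) → ℝ}
    {x : EuclideanSpace ℝ (Fin N)} (hu : ContDiffAt ℝ 2 u x) (hpos : 0 < u x) (c b : ℝ) :
    lap (fun y => c * u y ^ b) x = c * b * u x ^ (b - 1) * lap u x +
      c * b * (b - 1) * u x ^ (b - 2) *
        ∑ i, fderiv ℝ u x (EuclideanSpace.single i 1) ^ 2 := by
  have hdiff : DifferentiableAt ℝ u x := hu.differentiableAt (by norm_num)
  have hdiff_fderiv : DifferentiableAt ℝ (fderiv ℝ u) x :=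
    (hu.fderiv_right (m := 1) (by norm_num)).differentiableAt (by norm_num)
  have hnear : ∀ᶠ y in 𝓝 x, ContDiffAt ℝ 2 u y ∧ 0 < u y :=
    (hu.eventually (by simp)).and (hu.continuousAt.eventually_const_lt hpos)
  have hpow (y) (hy : DifferentiableAt ℝ u y) (hy0 : 0 < u y) (r : ℝ) :
      HasFDerivAt (fun z => u z ^ r) ((r * u y ^ (r - 1)) • fderiv ℝ u y) y :=
    hy.hasFDerivAt.rpow_const (Or.inl hy0.ne')
  unfold lap
  rw [Finset.mul_sum, Finset.mul_sum, ← Finset.sum_add_distrib]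
  refine Finset.sum_congr rfl fun i _ => ?_
  set e : EuclideanSpace ℝ (Fin N) := EuclideanSpace.single i 1
  have hfirst : (fun y => fderiv ℝ (fun z => c * u z ^ b) y e) =ᶠ[𝓝 x]
      fun y => c * b * (u y ^ (b - 1) * fderiv ℝ u y e) := by
    filter_upwards [hnear] with y hy
    rw [((hpow y (hy.1.differentiableAt (by norm_num)) hy.2 b).const_mul c).fderiv]
    simp only [smul_apply, smul_eq_mul]
    ring
  have hpartial : DifferentiableAt ℝ (fun y => fderiv ℝ u y e) x :=
    hdiff_fderiv.clm_apply (differentiableAt_const e)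
  rw [hfirst.fderiv_eq,
    (((hpow x hdiff hpos (b - 1)).fun_mul hpartial.hasFDerivAt).const_mul (c * b)).fderiv]
  simp only [smul_apply, add_apply, smul_eq_mul]
  rw [show b - 1 - 1 = b - 2 by ring]
  ring

/-- A positive supersolution of `-Δu = u^{p₀}` yields, after the power transformation
`u ↦ α^{1/(1-p)} u^{1/α}` with `α = (p-1)/(p₀-1)`, a positive supersolution of
`-Δv = v^p` for every larger exponent `p`. -/
theorem power_transform_supersolution
    (N : ℕ) (hN : 3 ≤ N) (U : Set (EuclideanSpace ℝ (Fin N))) (hUopen : IsOpen U)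
    (p₀ p : ℝ) (hp₀ : 1 < p₀) (hpp : p₀ < p)
    (α : ℝ) (hα : α = (p - 1) / (p₀ - 1))
    (u : EuclideanSpace ℝ (Fin N) → ℝ)
    (huC2 : ContDiffOn ℝ 2 u U) (hupos : ∀ x ∈ U, 0 < u x)
    (husuper : ∀ x ∈ U, -lap u x ≥ u x ^ p₀) :
    1 < α ∧
    ContDiffOn ℝ 2 (fun x => α ^ (-(1 / (p - 1))) * u x ^ (1 / α)) U ∧
    (∀ x ∈ U, 0 < α ^ (-(1 / (p - 1))) * u x ^ (1 / α)) ∧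
    (∀ x ∈ U, -lap (fun y => α ^ (-(1 / (p - 1))) * u y ^ (1 / α)) x
        ≥ (α ^ (-(1 / (p - 1))) * u x ^ (1 / α)) ^ p) := by
  have hp₀' : 0 < p₀ - 1 := by linarith
  have hp' : 0 < p - 1 := by linarith
  have hα1 : 1 < α := by
    rw [hα, one_lt_div hp₀']
    linarith
  have hα0 : 0 < α := by linarith
  have hcpos : 0 < α ^ (-(1 / (p - 1))) := Real.rpow_pos_of_pos hα0 _
  have hβ0 : 0 < 1 / α := by positivity
  have hβ1 : 1 / α < 1 := (div_lt_one hα0).2 hα1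
  refine ⟨hα1, ?_, fun x hx => mul_pos hcpos (Real.rpow_pos_of_pos (hupos x hx) _), ?_⟩
  · exact contDiffOn_const.mul (huC2.rpow_const_of_ne fun x hx => (hupos x hx).ne')
  intro x hx
  have hux := hupos x hx
  rw [lap_const_mul_rpow (huC2.contDiffAt (hUopen.mem_nhds hx)) hux]
  have hcp : (α ^ (-(1 / (p - 1)))) ^ p = α ^ (-(1 / (p - 1))) * (1 / α) := by
    rw [← Real.rpow_mul hα0.le, one_div α, ← Real.rpow_neg_one α, ← Real.rpow_add hα0]
    congr 1
    field_simp
    ring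
  have hup : (u x ^ (1 / α)) ^ p = u x ^ (1 / α - 1) * u x ^ p₀ := by
    rw [← Real.rpow_mul hux.le, ← Real.rpow_add hux]
    congr 1
    rw [hα]
    field_simp
    ring
  rw [Real.mul_rpow hcpos.le (Real.rpow_nonneg hux.le _), hcp, hup]
  set c := α ^ (-(1 / (p - 1)))
  set β := 1 / α
  set S := ∑ i, fderiv ℝ u x (EuclideanSpace.single i 1) ^ 2
  have hS : 0 ≤ S := Finset.sum_nonneg fun i _ => sq_nonneg _
  have hmain : c * β * u x ^ (β - 1) * u x ^ p₀ ≤ c * β * u x ^ (β - 1) * -lap u x :=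
    mul_le_mul_of_nonneg_left (husuper x hx) (by positivity)
  have hgrad : 0 ≤ c * β * (1 - β) * u x ^ (β - 2) * S := by
    have : 0 < 1 - β := by linarith
    positivity
  linarith
end

section
/- Let N ≥ 3 and let K be a nonempty cone in ℝ^N. Then there exists p₀ > 1 such that for every p with 1 < p < p₀ and every ρ > 0, there is no positive classical supersolution of -Δu = u^p on K ∩ {x : ‖x‖ > ρ}; that is, no u : ℝ^N → ℝ which is C² on K ∩ {‖x‖ > ρ}, positive there, and satisfies -Δu(x) ≥ u(x)^p on that set. (Laplacian case of the paper's Theorem 1.5, first part: for any cone-like domain the critical exponent is strictly greater than 1.) -/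
open scoped Pointwise

section Laplacian

variable {N : ℕ} {u φ : EuclideanSpace ℝ (Fin N) → ℝ} {x : EuclideanSpace ℝ (Fin N)}

lemma lap_sub_s12 (hu : ContDiffAt ℝ 2 u x) (hφ : ContDiffAt ℝ 2 φ x) :
    lap (fun y => u y - φ y) x = lap u x - lap φ x := by
  unfold lap
  rw [← Finset.sum_sub_distrib]
  refine Finset.sum_congr rfl fun i _ => ?_
  have hev : (fun y => fderiv ℝ (fun y => u y - φ y) y (EuclideanSpace.single i 1)) =ᶠ[nhds x]
      fun y => fderiv ℝ u y (EuclideanSpace.single i 1) -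
        fderiv ℝ φ y (EuclideanSpace.single i 1) := by
    filter_upwards [hu.eventually (by simp), hφ.eventually (by simp)] with y h1 h2
    rw [fderiv_fun_sub (h1.differentiableAt (by norm_num)) (h2.differentiableAt (by norm_num))]
    rfl
  have du : DifferentiableAt ℝ (fderiv ℝ u) x :=
    (hu.fderiv_right (m := 1) (by norm_num)).differentiableAt (by norm_num)
  have dφ : DifferentiableAt ℝ (fderiv ℝ φ) x :=
    (hφ.fderiv_right (m := 1) (by norm_num)).differentiableAt (by norm_num)
  rw [hev.fderiv_eq, fderiv_fun_sub (by fun_prop) (by fun_prop)]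
  rfl

lemma lap_nonneg_of_isLocalMin_s12 (hu : ContDiffAt ℝ 2 u x) (hmin : IsLocalMin u x) :
    0 ≤ lap u x := by
  refine Finset.sum_nonneg fun i _ => ?_
  set e : EuclideanSpace ℝ (Fin N) := EuclideanSpace.single i 1
  have hline : ∀ s : ℝ, HasDerivAt (fun s : ℝ => x + s • e) e s := fun s => by
    simpa using ((hasDerivAt_id s).smul_const e).const_add x
  have hcont : Filter.Tendsto (fun s : ℝ => x + s • e) (nhds 0) (nhds x) := by
    simpa using (hline 0).continuousAt.tendsto
  have du : DifferentiableAt ℝ (fun y => fderiv ℝ u y e) x := by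
    have := (hu.fderiv_right (m := 1) (by norm_num)).differentiableAt (by norm_num)
    fun_prop
  have hderiv : deriv (fun s : ℝ => u (x + s • e)) =ᶠ[nhds 0]
      fun s => fderiv ℝ u (x + s • e) e := by
    filter_upwards [hcont.eventually (hu.eventually (by simp))] with s hs
    exact ((hs.differentiableAt (by norm_num)).hasFDerivAt.comp_hasDerivAt s (hline s)).deriv
  have hderiv2 : deriv (deriv fun s : ℝ => u (x + s • e)) 0 =
      fderiv ℝ (fun y => fderiv ℝ u y e) x e := by
    rw [hderiv.deriv_eq]
    have h0 : x + (0 : ℝ) • e = x := by simp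
    have := HasFDerivAt.comp_hasDerivAt (0 : ℝ) (f := fun s : ℝ => x + s • e)
      (l := fun y => fderiv ℝ u y e) (by rw [h0]; exact du.hasFDerivAt) (hline 0)
    exact this.deriv
  have hmin' : IsLocalMin (fun s : ℝ => u (x + s • e)) 0 := by
    filter_upwards [hcont.eventually hmin] with s hs
    simpa using hs
  by_contra! hneg
  rw [← hderiv2] at hneg
  have hmax : IsLocalMax (fun s : ℝ => u (x + s • e)) 0 := by
    refine isLocalMax_of_deriv_deriv_neg hneg hmin'.deriv_eq_zero ?_
    have h0 : x + (0 : ℝ) • e = x := by simp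
    exact ContinuousAt.comp (g := u) (f := fun s : ℝ => x + s • e)
      (by rw [h0]; exact hu.continuousAt) (hline 0).continuousAt
  have hconst : (fun s : ℝ => u (x + s • e)) =ᶠ[nhds 0] fun _ => u (x + (0 : ℝ) • e) := by
    filter_upwards [hmin', hmax] with s h1 h2 using le_antisymm h2 h1
  have := hconst.deriv.deriv_eq
  simp at this
  simp [this] at hneg

/-- A weak comparison principle: a strict supersolution relative to `φ` that dominates `φ` off an
open subset `V` of a compact set dominates it on the whole compact set. -/
lemma le_of_lap_lt {D V : Set (EuclideanSpace ℝ (Fin N))} (hD : IsCompact D) (hV : IsOpen V)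
    (hVD : V ⊆ D) (hu : ∀ x ∈ D, ContDiffAt ℝ 2 u x) (hφ : ContDiff ℝ 2 φ)
    (hbdry : ∀ x ∈ D \ V, φ x ≤ u x) (hlap : ∀ x ∈ V, lap u x < lap φ x) :
    ∀ x ∈ D, φ x ≤ u x := by
  intro y hy
  have hcont : ContinuousOn (fun x => u x - φ x) D := fun x hx =>
    ((hu x hx).continuousAt.sub hφ.continuous.continuousAt).continuousWithinAt
  obtain ⟨x, hxD, hx⟩ := hD.exists_isMinOn ⟨y, hy⟩ hcont
  suffices φ x ≤ u x by
    have := hx hy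
    simp only [Set.mem_ofPred_eq] at this
    linarith
  by_cases hxV : x ∈ V
  · have hloc : IsLocalMin (fun x => u x - φ x) x :=
      hx.isLocalMin (Filter.mem_of_superset (hV.mem_nhds hxV) hVD)
    have := lap_nonneg_of_isLocalMin_s12 ((hu x hxD).sub hφ.contDiffAt) hloc
    rw [lap_sub_s12 (hu x hxD) hφ.contDiffAt] at this
    linarith [hlap x hxV]
  · exact hbdry x ⟨hxD, hxV⟩

/-- The radial barrier `a (exp (-α ‖x - c‖²) - b)`. -/
noncomputable def gaussianBarrier (c : EuclideanSpace ℝ (Fin N)) (a α b : ℝ)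
    (x : EuclideanSpace ℝ (Fin N)) : ℝ :=
  a * (Real.exp (-α * ‖x - c‖ ^ 2) - b)

lemma contDiff_gaussianBarrier (c : EuclideanSpace ℝ (Fin N)) (a α b : ℝ) :
    ContDiff ℝ 2 (gaussianBarrier c a α b) := by
  unfold gaussianBarrier
  have : ContDiff ℝ 2 fun x : EuclideanSpace ℝ (Fin N) => ‖x - c‖ ^ 2 :=
    (contDiff_id.sub contDiff_const).norm_sq ℝ
  fun_prop

lemma hasFDerivAt_exp_neg_norm_sq (c : EuclideanSpace ℝ (Fin N)) (α : ℝ)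
    (y : EuclideanSpace ℝ (Fin N)) :
    HasFDerivAt (fun x => Real.exp (-α * ‖x - c‖ ^ 2))
      ((Real.exp (-α * ‖y - c‖ ^ 2) * (-α * 2)) • innerSL ℝ (y - c)) y := by
  have h := ((((hasFDerivAt_id y).sub_const c).norm_sq).const_mul (-α)).exp
  refine h.congr_fderiv ?_
  ext z
  simp
  ring

lemma lap_gaussianBarrier (c : EuclideanSpace ℝ (Fin N)) (a α b : ℝ) :
    lap (gaussianBarrier c a α b) x =
      a * (4 * α ^ 2 * ‖x - c‖ ^ 2 - 2 * α * N) * Real.exp (-α * ‖x - c‖ ^ 2) := by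
  have hgrad : ∀ i : Fin N,
      (fun y => fderiv ℝ (gaussianBarrier c a α b) y (EuclideanSpace.single i 1)) =
        fun y => Real.exp (-α * ‖y - c‖ ^ 2) * (-2 * a * α * (y i - c i)) := fun i => by
    ext y
    have h := ((hasFDerivAt_exp_neg_norm_sq c α y).sub_const b).const_mul a
    rw [show gaussianBarrier c a α b = fun x => a * (Real.exp (-α * ‖x - c‖ ^ 2) - b) from rfl,
      h.fderiv]
    simp [EuclideanSpace.inner_single_right]
    ring
  have hsecond : ∀ i : Fin N,
      fderiv ℝ (fun y => fderiv ℝ (gaussianBarrier c a α b) y (EuclideanSpace.single i 1)) x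
        (EuclideanSpace.single i 1) =
      a * Real.exp (-α * ‖x - c‖ ^ 2) * (4 * α ^ 2 * (x i - c i) ^ 2 - 2 * α) := fun i => by
    rw [hgrad]
    have hlin : HasFDerivAt (fun y : EuclideanSpace ℝ (Fin N) => -2 * a * α * (y i - c i))
        ((-2 * a * α) • (EuclideanSpace.proj i : EuclideanSpace ℝ (Fin N) →L[ℝ] ℝ)) x :=
      ((EuclideanSpace.proj i : EuclideanSpace ℝ (Fin N) →L[ℝ] ℝ).hasFDerivAt.sub_const
        (c i)).const_mul _
    rw [((hasFDerivAt_exp_neg_norm_sq c α x).fun_mul hlin).fderiv]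
    simp [EuclideanSpace.inner_single_right]
    ring
  unfold lap
  rw [Finset.sum_congr rfl fun i _ => hsecond i, ← Finset.mul_sum, Finset.sum_sub_distrib,
    ← Finset.mul_sum, EuclideanSpace.real_norm_sq_eq (x - c)]
  simp
  ring

end Laplacian

section Estimates

variable {N : ℕ} {u : EuclideanSpace ℝ (Fin N) → ℝ} {c : EuclideanSpace ℝ (Fin N)} {r : ℝ}

/-- The constant in the propagation of positivity for superharmonic functions. -/
noncomputable def propagationConst (N : ℕ) : ℝ := Real.exp (-9 * N) - Real.exp (-16 * N)

lemma propagationConst_pos (hN : 0 < N) : 0 < propagationConst N := by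
  have : (0 : ℝ) < N := by exact_mod_cast hN
  exact sub_pos.2 (Real.exp_lt_exp.2 (by linarith))

lemma propagationConst_lt_one : propagationConst N < 1 := by
  have h : Real.exp (-9 * N) ≤ 1 := Real.exp_le_one_iff.2 (by simp)
  have := Real.exp_pos (-16 * N)
  unfold propagationConst
  linarith

lemma propagation_of_superharmonic (hN : 0 < N) (hr : 0 < r)
    (hu : ∀ x ∈ Metric.closedBall c (4 * r), ContDiffAt ℝ 2 u x)
    (hpos : ∀ x ∈ Metric.closedBall c (4 * r), 0 < u x)
    (hlap : ∀ x ∈ Metric.closedBall c (4 * r), lap u x ≤ 0) {μ : ℝ} (hμ : 0 < μ)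
    (hcore : ∀ x ∈ Metric.closedBall c r, μ ≤ u x) :
    ∀ x ∈ Metric.closedBall c (3 * r), propagationConst N * μ ≤ u x := by
  have hN' : (0 : ℝ) < N := by exact_mod_cast hN
  set α : ℝ := N / r ^ 2 with hα
  have hαpos : 0 < α := by positivity
  have hαr : α * r ^ 2 = N := by rw [hα]; field_simp
  have hcomp := le_of_lap_lt (u := u) (φ := gaussianBarrier c μ α (Real.exp (-16 * N)))
    (isCompact_closedBall c (4 * r))
    (Metric.isOpen_ball.sdiff Metric.isClosed_closedBall :
      IsOpen (Metric.ball c (4 * r) \ Metric.closedBall c r))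
    (Set.sdiff_subset.trans Metric.ball_subset_closedBall) hu (contDiff_gaussianBarrier _ _ _ _)
    ?_ ?_
  · intro x hx
    refine le_trans ?_ (hcomp x (Metric.closedBall_subset_closedBall (by linarith) hx))
    rw [mem_closedBall_iff_norm] at hx
    unfold gaussianBarrier propagationConst
    rw [mul_comm]
    have : ‖x - c‖ ^ 2 ≤ (3 * r) ^ 2 := by gcongr
    have : -9 * (N : ℝ) ≤ -α * ‖x - c‖ ^ 2 := by nlinarith
    gcongr
  · rintro x ⟨hx, hxV⟩
    unfold gaussianBarrier
    by_cases hxr : x ∈ Metric.closedBall c r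
    · refine le_trans ?_ (hcore x hxr)
      have h1 : Real.exp (-α * ‖x - c‖ ^ 2) ≤ 1 :=
        Real.exp_le_one_iff.2 (by have := mul_nonneg hαpos.le (sq_nonneg ‖x - c‖); linarith)
      have h2 := Real.exp_pos (-16 * N)
      nlinarith
    · refine le_trans ?_ (hpos x hx).le
      have hxR : 4 * r ≤ ‖x - c‖ := by
        by_contra! h
        exact hxV ⟨mem_ball_iff_norm.2 h, hxr⟩
      refine mul_nonpos_of_nonneg_of_nonpos hμ.le (sub_nonpos.2 (Real.exp_le_exp.2 ?_))
      have : (4 * r) ^ 2 ≤ ‖x - c‖ ^ 2 := by gcongr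
      nlinarith
  · rintro x ⟨hx, hxr⟩
    refine (hlap x (Metric.ball_subset_closedBall hx)).trans_lt ?_
    rw [lap_gaussianBarrier]
    rw [mem_closedBall_iff_norm, not_le] at hxr
    have h1 : r ^ 2 < ‖x - c‖ ^ 2 := by gcongr
    have h2 : 0 < 4 * α ^ 2 * ‖x - c‖ ^ 2 - 2 * α * N := by
      rw [← hαr]
      have : 0 < α ^ 2 := by positivity
      nlinarith
    positivity

lemma lower_bound_of_le_neg_lap (hN : 0 < N) (hr : 0 < r)
    (hu : ∀ x ∈ Metric.closedBall c (2 * r), ContDiffAt ℝ 2 u x)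
    (hpos : ∀ x ∈ Metric.closedBall c (2 * r), 0 < u x) {f : ℝ} (hf : 0 < f)
    (hlap : ∀ x ∈ Metric.closedBall c (2 * r), f ≤ -lap u x) :
    ∀ x ∈ Metric.closedBall c r,
      f * r ^ 2 / (4 * N) * (Real.exp (-1) - Real.exp (-4)) ≤ u x := by
  have hN' : (0 : ℝ) < N := by exact_mod_cast hN
  set α : ℝ := 1 / r ^ 2 with hα
  have hαpos : 0 < α := by positivity
  have hαr : α * r ^ 2 = 1 := by rw [hα]; field_simp
  set a : ℝ := f * r ^ 2 / (4 * N) with ha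
  have hapos : 0 < a := by positivity
  have haα : a * α * N = f / 4 := by rw [ha, hα]; field_simp
  have hcomp := le_of_lap_lt (u := u) (φ := gaussianBarrier c a α (Real.exp (-4)))
    (isCompact_closedBall c (2 * r)) (Metric.isOpen_ball (x := c) (ε := 2 * r))
    Metric.ball_subset_closedBall hu (contDiff_gaussianBarrier _ _ _ _) ?_ ?_
  · intro x hx
    refine le_trans ?_ (hcomp x (Metric.closedBall_subset_closedBall (by linarith) hx))
    rw [mem_closedBall_iff_norm] at hx
    unfold gaussianBarrier
    gcongr
    have : ‖x - c‖ ^ 2 ≤ r ^ 2 := by gcongr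
    nlinarith
  · rintro x ⟨hx, hxV⟩
    refine le_trans ?_ (hpos x hx).le
    rw [mem_ball_iff_norm, not_lt] at hxV
    refine mul_nonpos_of_nonneg_of_nonpos hapos.le (sub_nonpos.2 (Real.exp_le_exp.2 ?_))
    have : (2 * r) ^ 2 ≤ ‖x - c‖ ^ 2 := by gcongr
    nlinarith
  · intro x hx
    have h0 := hlap x (Metric.ball_subset_closedBall hx)
    rw [lap_gaussianBarrier]
    set E := Real.exp (-α * ‖x - c‖ ^ 2)
    have hE0 : 0 < E := Real.exp_pos _
    have hE1 : E ≤ 1 :=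
      Real.exp_le_one_iff.2 (by have := mul_nonneg hαpos.le (sq_nonneg ‖x - c‖); linarith)
    have h1 : a * (4 * α ^ 2 * ‖x - c‖ ^ 2 - 2 * α * N) * E =
      4 * a * α ^ 2 * ‖x - c‖ ^ 2 * E - 2 * (a * α * N) * E := by ring
    have h2 : 0 ≤ 4 * a * α ^ 2 * ‖x - c‖ ^ 2 * E := by positivity
    rw [h1, haα]
    nlinarith

/-- The constant in the interior decay bound for supersolutions. -/
noncomputable def decayConst (N : ℕ) : ℝ :=
  propagationConst N * ((Real.exp (-1) - Real.exp (-4)) / (4 * N))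

lemma decayConst_pos (hN : 0 < N) : 0 < decayConst N := by
  have hN' : (0 : ℝ) < N := by exact_mod_cast hN
  have h : 0 < Real.exp (-1) - Real.exp (-4) := sub_pos.2 (Real.exp_lt_exp.2 (by norm_num))
  have := propagationConst_pos hN
  unfold decayConst
  positivity

lemma interior_decay (hN : 0 < N) (hr : 0 < r) {p : ℝ} (hp : 1 < p)
    (hu : ∀ x ∈ Metric.closedBall c (4 * r), ContDiffAt ℝ 2 u x)
    (hpos : ∀ x ∈ Metric.closedBall c (4 * r), 0 < u x)
    (hlap : ∀ x ∈ Metric.closedBall c (4 * r), u x ^ p ≤ -lap u x) {m : ℝ} (hm : 0 < m)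
    (hmu : ∀ x ∈ Metric.closedBall c (2 * r), m ≤ u x) :
    decayConst N * m ^ (p - 1) * r ^ 2 ≤ 1 := by
  have hN' : (0 : ℝ) < N := by exact_mod_cast hN
  have hsub : Metric.closedBall c (2 * r) ⊆ Metric.closedBall c (4 * r) :=
    Metric.closedBall_subset_closedBall (by linarith)
  obtain ⟨z, hz, hzmin⟩ := (isCompact_closedBall c (2 * r)).exists_isMinOn
    ⟨c, Metric.mem_closedBall_self (by positivity)⟩
    (fun x hx => (hu x (hsub hx)).continuousAt.continuousWithinAt : ContinuousOn u _)
  have hz0 := hpos z (hsub hz)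
  have hcore := lower_bound_of_le_neg_lap hN hr (fun x hx => hu x (hsub hx))
    (fun x hx => hpos x (hsub hx)) (Real.rpow_pos_of_pos hz0 p)
    (fun x hx => (Real.rpow_le_rpow hz0.le (hzmin hx) (by linarith)).trans (hlap x (hsub hx)))
  have hexp : 0 < Real.exp (-1) - Real.exp (-4) := sub_pos.2 (Real.exp_lt_exp.2 (by norm_num))
  have hprop := propagation_of_superharmonic hN hr hu hpos
    (fun x hx => by linarith [hlap x hx, Real.rpow_pos_of_pos (hpos x hx) p]) (by positivity) hcore
    z (Metric.closedBall_subset_closedBall (by linarith) hz)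
  have hsplit : u z ^ p = u z ^ (p - 1) * u z := by
    rw [← Real.rpow_add_one hz0.ne']
    ring_nf
  have hbound : decayConst N * u z ^ (p - 1) * r ^ 2 ≤ 1 := by
    rw [hsplit] at hprop
    refine le_of_mul_le_mul_right ?_ hz0
    calc decayConst N * u z ^ (p - 1) * r ^ 2 * u z = _ := by unfold decayConst; ring
      _ ≤ u z := hprop
      _ = 1 * u z := (one_mul _).symm
  refine le_trans ?_ hbound
  have := decayConst_pos hN
  have := hmu z hz
  gcongr

end Estimates

/-- There is no positive supersolution on a union of geometrically growing balls
when the growth rate beats the loss of positivity from ball to ball. -/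
lemma no_supersolution_of_chain {N : ℕ} (hN : 0 < N) {u : EuclideanSpace ℝ (Fin N) → ℝ}
    {c : EuclideanSpace ℝ (Fin N)} {r l p : ℝ} (hr : 0 < r) (hl : 1 < l) (hp : 1 < p)
    (hlr : (l - 1) * (‖c‖ + r) ≤ 2 * r)
    (hrate : 1 < propagationConst N ^ (p - 1) * l ^ 2)
    (hu : ∀ k : ℕ, ∀ x ∈ Metric.closedBall (l ^ k • c) (4 * (l ^ k * r)), ContDiffAt ℝ 2 u x)
    (hpos : ∀ k : ℕ, ∀ x ∈ Metric.closedBall (l ^ k • c) (4 * (l ^ k * r)), 0 < u x)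
    (hlap : ∀ k : ℕ, ∀ x ∈ Metric.closedBall (l ^ k • c) (4 * (l ^ k * r)),
      u x ^ p ≤ -lap u x) : False := by
  have hκ := propagationConst_pos hN
  set κ := propagationConst N
  have hrk : ∀ k : ℕ, 0 < l ^ k * r := fun k => by positivity
  have hprop : ∀ k : ℕ, ∀ μ : ℝ, 0 < μ →
      (∀ x ∈ Metric.closedBall (l ^ k • c) (l ^ k * r), μ ≤ u x) →
      ∀ x ∈ Metric.closedBall (l ^ k • c) (3 * (l ^ k * r)), κ * μ ≤ u x := fun k μ hμ h =>
    propagation_of_superharmonic hN (hrk k) (hu k) (hpos k)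
      (fun x hx => by linarith [hlap k x hx, Real.rpow_pos_of_pos (hpos k x hx) p]) hμ h
  obtain ⟨m, hm, hm0⟩ : ∃ m : ℝ, 0 < m ∧ ∀ x ∈ Metric.closedBall c r, m ≤ u x := by
    have hsub : Metric.closedBall c r ⊆ Metric.closedBall (l ^ 0 • c) (4 * (l ^ 0 * r)) := by
      simpa using Metric.closedBall_subset_closedBall (x := c) (by linarith : r ≤ 4 * r)
    obtain ⟨z, hz, hzmin⟩ := (isCompact_closedBall c r).exists_isMinOn
      ⟨c, Metric.mem_closedBall_self hr.le⟩
      (fun x hx => (hu 0 x (hsub hx)).continuousAt.continuousWithinAt : ContinuousOn u _)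
    exact ⟨u z, hpos 0 z (hsub hz), fun x hx => hzmin hx⟩
  have hchain : ∀ k : ℕ, ∀ x ∈ Metric.closedBall (l ^ k • c) (l ^ k * r), κ ^ k * m ≤ u x := by
    intro k
    induction k with
    | zero => simpa using hm0
    | succ k ih =>
      intro x hx
      rw [pow_succ', mul_assoc]
      refine hprop k _ (by positivity) ih x ?_
      refine Metric.closedBall_subset_closedBall' ?_ hx
      have hdist : dist (l ^ (k + 1) • c) (l ^ k • c) = l ^ k * ((l - 1) * ‖c‖) := by
        rw [dist_eq_norm, ← sub_smul, norm_smul, Real.norm_of_nonneg]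
        · ring
        · rw [pow_succ]
          nlinarith [pow_pos (by linarith : 0 < l) k]
      rw [hdist, pow_succ]
      nlinarith [mul_le_mul_of_nonneg_left hlr (pow_pos (by linarith : 0 < l) k).le]
  have hbound : ∀ k : ℕ,
      (decayConst N * (κ * m) ^ (p - 1) * r ^ 2) * (κ ^ (p - 1) * l ^ 2) ^ k ≤ 1 := by
    intro k
    have h := interior_decay hN (hrk k) hp (hu k) (hpos k) (hlap k)
      (by positivity : 0 < κ * (κ ^ k * m))
      (fun x hx => hprop k _ (by positivity) (hchain k) x
        (Metric.closedBall_subset_closedBall (by linarith [hrk k]) hx))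
    refine le_of_eq_of_le ?_ h
    have hpow : (κ ^ k) ^ (p - 1) = (κ ^ (p - 1)) ^ k := by
      rw [← Real.rpow_natCast κ k, ← Real.rpow_mul hκ.le, mul_comm (k : ℝ), Real.rpow_mul hκ.le,
        Real.rpow_natCast]
    rw [show κ * (κ ^ k * m) = (κ * m) * κ ^ k by ring,
      Real.mul_rpow (x := κ * m) (by positivity) (by positivity), hpow]
    ring
  have hA : 0 < decayConst N * (κ * m) ^ (p - 1) * r ^ 2 := by
    have := decayConst_pos hN
    positivity
  obtain ⟨k, hk⟩ := pow_unbounded_of_one_lt (1 / (decayConst N * (κ * m) ^ (p - 1) * r ^ 2)) hrate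
  rw [div_lt_iff₀ hA, mul_comm] at hk
  exact absurd (hbound k) (not_le.2 hk)

/-- For any nonempty cone `K ⊆ ℝ^N`, the critical exponent of `-Δu = u^p` on `K`
is strictly greater than `1`: there is `p₀ > 1` such that for all `1 < p < p₀` and
all `ρ > 0` there is no positive supersolution on `K ∩ {‖x‖ > ρ}`. -/
theorem critical_exponent_greater_than_one
    (N : ℕ) (hN : 3 ≤ N)
    (K : Set (EuclideanSpace ℝ (Fin N))) (hKopen : IsOpen K)
    (hK0 : K ⊆ {x | x ≠ 0}) (hKcone : ∀ t : ℝ, 0 < t → t • K = K) (hKne : K.Nonempty) :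
    ∃ p₀ : ℝ, 1 < p₀ ∧ ∀ p : ℝ, 1 < p → p < p₀ → ∀ ρ : ℝ, 0 < ρ →
      ¬ ∃ u : EuclideanSpace ℝ (Fin N) → ℝ,
          ContDiffOn ℝ 2 u {x | x ∈ K ∧ ρ < ‖x‖} ∧
          (∀ x ∈ K, ρ < ‖x‖ → 0 < u x) ∧
          (∀ x ∈ K, ρ < ‖x‖ → -lap u x ≥ u x ^ p) := by
  have hN0 : 0 < N := by omega
  obtain ⟨x₀, hx₀⟩ := hKne
  have hx₀n : 0 < ‖x₀‖ := norm_pos_iff.2 (hK0 hx₀)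
  obtain ⟨ε, hε, hball⟩ := Metric.isOpen_iff.1 hKopen x₀ hx₀
  obtain ⟨δ, hδ, hδε, hδx⟩ : ∃ δ : ℝ, 0 < δ ∧ 4 * δ < ε ∧ 8 * δ ≤ ‖x₀‖ :=
    ⟨min ε ‖x₀‖ / 8, by positivity, by linarith [min_le_left ε ‖x₀‖],
      by linarith [min_le_right ε ‖x₀‖]⟩
  have hκ := propagationConst_pos hN0
  set κ := propagationConst N
  have hlogκ : Real.log κ < 0 := Real.log_neg hκ propagationConst_lt_one
  set l : ℝ := 1 + 2 * δ / (‖x₀‖ + δ) with hldef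
  have hl : 1 < l := lt_add_of_pos_right _ (by positivity)
  have hlogl : 0 < Real.log l := Real.log_pos hl
  refine ⟨1 + 2 * Real.log l / (-Real.log κ),
    lt_add_of_pos_right _ (div_pos (by positivity) (by linarith)), ?_⟩
  rintro p hp hpp ρ hρ ⟨u, hu, hpos, hlap⟩
  have hrate : 1 < κ ^ (p - 1) * l ^ 2 := by
    rw [← Real.log_pos_iff (by positivity), Real.log_mul (by positivity) (by positivity),
      Real.log_rpow hκ, Real.log_pow]
    have : p - 1 < 2 * Real.log l / (-Real.log κ) := by linarith
    rw [lt_div_iff₀ (by linarith)] at this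
    push_cast
    linarith
  set t : ℝ := 3 * ρ / ‖x₀‖ with htdef
  have ht : 0 < t := by positivity
  have hsub : ∀ k : ℕ, ∀ x ∈ Metric.closedBall (l ^ k • t • x₀) (4 * (l ^ k * (t * δ))),
      x ∈ K ∧ ρ < ‖x‖ := by
    intro k x hx
    have hlk : 1 ≤ l ^ k := one_le_pow₀ hl.le
    set s : ℝ := l ^ k * t with hs
    have hspos : 0 < s := by positivity
    have hy : ‖s⁻¹ • x - x₀‖ ≤ 4 * δ := by
      rw [mem_closedBall_iff_norm, smul_smul] at hx
      have : s⁻¹ • x - x₀ = s⁻¹ • (x - s • x₀) := by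
        rw [smul_sub, inv_smul_smul₀ hspos.ne']
      rw [this, norm_smul, Real.norm_of_nonneg (by positivity), inv_mul_le_iff₀ hspos]
      refine hx.trans (le_of_eq ?_)
      rw [hs]
      ring
    refine ⟨?_, ?_⟩
    · rw [← hKcone s hspos, Set.mem_smul_set_iff_inv_smul_mem₀ hspos.ne']
      exact hball (mem_ball_iff_norm.2 (by linarith))
    · have h1 : ‖x₀‖ / 2 ≤ ‖s⁻¹ • x‖ := by
        have := norm_sub_norm_le x₀ (s⁻¹ • x)
        rw [norm_sub_rev] at this
        linarith
      rw [norm_smul, Real.norm_of_nonneg (by positivity), inv_mul_eq_div, le_div_iff₀ hspos] at h1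
      have h2 : t * ‖x₀‖ = 3 * ρ := by rw [htdef]; field_simp
      have h3 : 3 * ρ ≤ s * ‖x₀‖ := by
        rw [hs, mul_assoc, h2]
        nlinarith
      linarith
  have hopen : IsOpen {x | x ∈ K ∧ ρ < ‖x‖} :=
    hKopen.inter (isOpen_lt continuous_const continuous_norm)
  refine no_supersolution_of_chain hN0 (u := u) (c := t • x₀) (r := t * δ) (by positivity) hl hp
    ?_ hrate (fun k x hx => hu.contDiffAt (hopen.mem_nhds (hsub k x hx)))
    (fun k x hx => hpos x (hsub k x hx).1 (hsub k x hx).2)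
    (fun k x hx => hlap x (hsub k x hx).1 (hsub k x hx).2)
  rw [norm_smul, Real.norm_of_nonneg ht.le, hldef]
  refine le_of_eq ?_
  field_simp
  ring
end

section
/- Let N ≥ 3 and let K be a nonempty cone in ℝ^N. Suppose there exists a nonempty cone K' in ℝ^N with K' ∩ K = ∅ (i.e. the complement of K contains a nonempty open cone). Then there exist p with 1 < p < N/(N-2), ρ > 0, and a positive classical supersolution of -Δu = u^p on K ∩ {x : ‖x‖ > ρ}; that is, a function u : ℝ^N → ℝ which is C² on K ∩ {‖x‖ > ρ}, positive there, and satisfies -Δu(x) ≥ u(x)^p on that set. (Laplacian case of the paper's Theorem 1.5, second part: if the complement of the cone has nonempty interior, the critical exponent is strictly less than N/(N-2).) -/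
open scoped Pointwise

open scoped RealInnerProductSpace

section Norm

variable {E : Type*} [NormedAddCommGroup E] [InnerProductSpace ℝ E]

lemma hasFDerivAt_norm_of_ne_zero {x : E} (hx : x ≠ 0) :
    HasFDerivAt (fun y : E => ‖y‖) (‖x‖⁻¹ • innerSL ℝ x) x := by
  have h := (hasStrictFDerivAt_norm_sq x).hasFDerivAt.sqrt (by positivity)
  simp only [Real.sqrt_sq (norm_nonneg _)] at h
  convert h using 1
  ext v
  have := norm_ne_zero_iff.mpr hx
  simp
  field_simp

/-- The function `‖x‖ ^ a * exp (l * ⟪e, x⟫ / ‖x‖)`, written as one exponential. -/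
noncomputable def radialExp (e : E) (a l : ℝ) (x : E) : ℝ :=
  Real.exp (a * Real.log ‖x‖ + l * (⟪e, x⟫ * ‖x‖⁻¹))

lemma contDiffAt_radialExp (e : E) (a l : ℝ) {x : E} (hx : x ≠ 0) :
    ContDiffAt ℝ 2 (radialExp e a l) x := by
  have hn : ContDiffAt ℝ 2 (fun y : E => ‖y‖) x := contDiffAt_norm ℝ hx
  have h0 := norm_ne_zero_iff.mpr hx
  have hi : ContDiffAt ℝ 2 (fun y : E => ⟪e, y⟫) x := contDiffAt_const.inner ℝ contDiffAt_id
  exact ((contDiffAt_const.mul (hn.log h0)).add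
    (contDiffAt_const.mul (hi.mul (hn.inv h0)))).exp

/-- The logarithmic derivative of `radialExp e a l` at `x` in the direction `v`. -/
noncomputable def radialExpLogDeriv (e : E) (a l : ℝ) (v x : E) : ℝ :=
  a * (⟪x, v⟫ * ‖x‖⁻¹ ^ 2) + l * (⟪e, v⟫ * ‖x‖⁻¹ - ⟪e, x⟫ * ⟪x, v⟫ * ‖x‖⁻¹ ^ 3)

lemma hasFDerivAt_norm_inv {x : E} (hx : x ≠ 0) :
    HasFDerivAt (fun y : E => ‖y‖⁻¹) (-‖x‖⁻¹ ^ 3 • innerSL ℝ x) x := by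
  have h0 := norm_ne_zero_iff.mpr hx
  have h := (hasDerivAt_inv h0).comp_hasFDerivAt x (hasFDerivAt_norm_of_ne_zero hx)
  refine h.congr_fderiv ?_
  ext v
  simp
  field_simp

lemma fderiv_radialExp (e : E) (a l : ℝ) {x : E} (hx : x ≠ 0) (v : E) :
    fderiv ℝ (radialExp e a l) x v = radialExp e a l x * radialExpLogDeriv e a l v x := by
  have h0 := norm_ne_zero_iff.mpr hx
  have hi : HasFDerivAt (fun y : E => ⟪e, y⟫) (innerSL ℝ e) x := (innerSL ℝ e).hasFDerivAt
  have h := ((((hasFDerivAt_norm_of_ne_zero hx).log h0).const_mul a).add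
    ((hi.mul (hasFDerivAt_norm_inv hx)).const_mul l)).exp
  change HasFDerivAt (radialExp e a l) _ x at h
  rw [h.fderiv]
  simp [radialExp, radialExpLogDeriv]
  ring

lemma fderiv_fderiv_radialExp (e : E) (a l : ℝ) {x : E} (hx : x ≠ 0) (v : E) :
    fderiv ℝ (fun y => fderiv ℝ (radialExp e a l) y v) x v =
      radialExp e a l x * (radialExpLogDeriv e a l v x ^ 2 +
        (a * (⟪v, v⟫ * ‖x‖⁻¹ ^ 2 - 2 * ⟪x, v⟫ ^ 2 * ‖x‖⁻¹ ^ 4) +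
          l * (-2 * ⟪e, v⟫ * ⟪x, v⟫ * ‖x‖⁻¹ ^ 3 - ⟪e, x⟫ * ⟪v, v⟫ * ‖x‖⁻¹ ^ 3 +
            3 * ⟪e, x⟫ * ⟪x, v⟫ ^ 2 * ‖x‖⁻¹ ^ 5))) := by
  have heq : (fun y => fderiv ℝ (radialExp e a l) y v) =ᶠ[nhds x]
      fun y => radialExp e a l y * radialExpLogDeriv e a l v y := by
    filter_upwards [isOpen_ne.mem_nhds hx] with y hy using fderiv_radialExp e a l hy v
  have hi : HasFDerivAt (fun y : E => ⟪e, y⟫) (innerSL ℝ e) x := (innerSL ℝ e).hasFDerivAt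
  have hv : HasFDerivAt (fun y : E => ⟪y, v⟫) (innerSL ℝ v) x := by
    simpa only [innerSL_apply_apply, real_inner_comm] using
      (innerSL ℝ v).hasFDerivAt.congr_of_eventuallyEq
        (.of_forall fun y : E => real_inner_comm v y)
  have hR := hasFDerivAt_norm_inv hx
  have hG := ((contDiffAt_radialExp e a l hx).differentiableAt (by norm_num)).hasFDerivAt
  have h := hG.mul (((hv.mul (hR.pow 2)).const_mul a).add
    (((hR.const_mul ⟪e, v⟫).sub ((hi.mul hv).mul (hR.pow 3))).const_mul l))
  change HasFDerivAt (fun y => radialExp e a l y * radialExpLogDeriv e a l v y) _ x at h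
  rw [heq.fderiv_eq, h.fderiv]
  simp [fderiv_radialExp e a l hx v, radialExpLogDeriv]
  ring

end Norm

lemma lap_radialExp {N : ℕ} {e : EuclideanSpace ℝ (Fin N)} (he : ‖e‖ = 1) (a l : ℝ)
    {x : EuclideanSpace ℝ (Fin N)} (hx : x ≠ 0) :
    lap (radialExp e a l) x = radialExp e a l x * ‖x‖⁻¹ ^ 2 *
      (a ^ 2 + a * (N - 2) + l ^ 2 * (1 - (⟪e, x⟫ * ‖x‖⁻¹) ^ 2) -
        l * (N - 1) * (⟪e, x⟫ * ‖x‖⁻¹)) := by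
  have h0 := norm_ne_zero_iff.mpr hx
  have hee : ∑ i, e i * e i = 1 := by
    have := EuclideanSpace.real_norm_sq_eq e
    rw [he] at this
    simpa [sq] using this.symm
  have hxx : ∑ i, x i * x i = ‖x‖ ^ 2 := by
    simpa [sq] using (EuclideanSpace.real_norm_sq_eq x).symm
  have hex : ∑ i, e i * x i = ⟪e, x⟫ := by
    simp [PiLp.inner_apply, mul_comm]
  unfold lap
  simp only [fderiv_fderiv_radialExp e a l hx, radialExpLogDeriv, EuclideanSpace.inner_single_right,
    conj_trivial, PiLp.single_apply, if_true, one_mul, mul_one]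
  rw [← Finset.mul_sum, mul_assoc (radialExp e a l x)]
  congr 1
  set τ := ⟪e, x⟫
  set R := ‖x‖⁻¹ with hR
  have hRx : R ^ 2 * ‖x‖ ^ 2 = 1 := by rw [hR]; field_simp
  have key : ∀ i, (a * (x i * R ^ 2) + l * (e i * R - τ * x i * R ^ 3)) ^ 2 +
      (a * (R ^ 2 - 2 * x i ^ 2 * R ^ 4) +
        l * (-2 * e i * x i * R ^ 3 - τ * R ^ 3 + 3 * τ * x i ^ 2 * R ^ 5)) =
      (a ^ 2 * R ^ 4 + l ^ 2 * τ ^ 2 * R ^ 6 - 2 * a * l * τ * R ^ 5 - 2 * a * R ^ 4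
        + 3 * l * τ * R ^ 5) * (x i * x i) + l ^ 2 * R ^ 2 * (e i * e i)
      + (2 * a * l * R ^ 3 - 2 * l ^ 2 * τ * R ^ 4 - 2 * l * R ^ 3) * (e i * x i)
      + (a * R ^ 2 - l * τ * R ^ 3) := fun i => by ring
  simp only [key, Finset.sum_add_distrib, ← Finset.mul_sum, hee, hxx, hex, Finset.sum_const, Finset.card_univ,
    Fintype.card_fin, nsmul_eq_mul]
  linear_combination (a ^ 2 * R ^ 2 + l ^ 2 * τ ^ 2 * R ^ 4 - 2 * a * l * τ * R ^ 3
    - 2 * a * R ^ 2 + 3 * l * τ * R ^ 3) * hRx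

lemma lap_eq_laplacian {N : ℕ} {u : EuclideanSpace ℝ (Fin N) → ℝ}
    {x : EuclideanSpace ℝ (Fin N)} (hu : ContDiffAt ℝ 2 u x) :
    lap u x = Laplacian.laplacian u x := by
  have hd : DifferentiableAt ℝ (fderiv ℝ u) x :=
    (hu.fderiv_right (m := 1) (by norm_num)).differentiableAt (by norm_num)
  rw [InnerProductSpace.laplacian_eq_iteratedFDeriv_orthonormalBasis u
    (EuclideanSpace.basisFun (Fin N) ℝ)]
  simp only [lap, iteratedFDeriv_two_apply, EuclideanSpace.basisFun_apply]
  refine Finset.sum_congr rfl fun i _ => ?_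
  rw [fderiv_clm_apply hd (differentiableAt_const _)]
  simp

lemma lap_const_mul_sub {N : ℕ} {u v : EuclideanSpace ℝ (Fin N) → ℝ}
    {x : EuclideanSpace ℝ (Fin N)} (hu : ContDiffAt ℝ 2 u x) (hv : ContDiffAt ℝ 2 v x) (b c : ℝ) :
    lap (fun y => b * (c * u y - v y)) x = b * (c * lap u x - lap v x) := by
  have hcu : ContDiffAt ℝ 2 (c • u) x := hu.const_smul c
  have hd : ContDiffAt ℝ 2 (c • u - v) x := hcu.sub hv
  have hbd : ContDiffAt ℝ 2 (b • (c • u - v)) x := hd.const_smul b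
  rw [lap_eq_laplacian hu, lap_eq_laplacian hv]
  change lap (b • (c • u - v)) x = _
  rw [lap_eq_laplacian hbd, InnerProductSpace.laplacian_smul b hd,
    hcu.laplacian_sub hv, InnerProductSpace.laplacian_smul c hu]
  rfl

lemma exists_inner_le_of_disjoint_cones {E : Type*} [NormedAddCommGroup E] [InnerProductSpace ℝ E]
    {K K' : Set E} (hK0 : K ⊆ {x | x ≠ 0}) (hKcone : ∀ t : ℝ, 0 < t → t • K = K)
    (hK'open : IsOpen K') (hK'0 : K' ⊆ {x | x ≠ 0}) (hK'cone : ∀ t : ℝ, 0 < t → t • K' = K')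
    (hK'ne : K'.Nonempty) (hdisj : K' ∩ K = ∅) :
    ∃ (e : E) (d : ℝ), ‖e‖ = 1 ∧ 0 < d ∧ ∀ x ∈ K, ⟪e, x⟫ * ‖x‖⁻¹ ≤ 1 - d := by
  obtain ⟨z, hz⟩ := hK'ne
  have hz0 : 0 < ‖z‖ := norm_pos_iff.mpr (hK'0 hz)
  have he : ‖z‖⁻¹ • z ∈ K' := by
    rw [← hK'cone _ (inv_pos.mpr hz0)]
    exact Set.smul_mem_smul_set hz
  have he1 : ‖‖z‖⁻¹ • z‖ = 1 := by
    rw [norm_smul, norm_inv, norm_norm, inv_mul_cancel₀ hz0.ne']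
  generalize ‖z‖⁻¹ • z = e at he he1
  obtain ⟨δ, hδ, hball⟩ := Metric.isOpen_iff.mp hK'open e he
  refine ⟨e, δ ^ 2 / 2, he1, by positivity, fun x hx => ?_⟩
  have hx0 : 0 < ‖x‖ := norm_pos_iff.mpr (hK0 hx)
  have hy : ‖x‖⁻¹ • x ∈ K := by
    rw [← hKcone _ (inv_pos.mpr hx0)]
    exact Set.smul_mem_smul_set hx
  have hy1 : ‖‖x‖⁻¹ • x‖ = 1 := by
    rw [norm_smul, norm_inv, norm_norm, inv_mul_cancel₀ hx0.ne']
  have hdist : δ ≤ ‖e - ‖x‖⁻¹ • x‖ := by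
    by_contra! hlt
    have hmem : ‖x‖⁻¹ • x ∈ K' ∩ K :=
      ⟨hball (by rwa [Metric.mem_ball, dist_comm, dist_eq_norm]), hy⟩
    simp [hdisj] at hmem
  have hsq := norm_sub_sq_real e (‖x‖⁻¹ • x)
  rw [he1, hy1, real_inner_smul_right] at hsq
  nlinarith [pow_le_pow_left₀ hδ.le hdist 2]

lemma exists_pos_le_quadratic {M d : ℝ} (hM : 0 < M) (hd : 0 < d) :
    ∃ l c : ℝ, 0 < l ∧ 0 < c ∧ ∀ t, -1 ≤ t → t ≤ 1 - d →
      c ≤ l ^ 2 * (1 - t ^ 2) - l * M * t := by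
  have hl : 0 < 4 * M / d := by positivity
  have hld : 4 * M / d * d = 4 * M := by field_simp
  generalize 4 * M / d = l at hl hld
  refine ⟨l, l * M / 2, hl, by positivity, fun t ht1 ht2 => ?_⟩
  have hlM := mul_pos hl hM
  have ht : t ≤ 1 := by linarith
  rcases le_total t (-1 / 2) with h | h
  · have : 0 ≤ l ^ 2 * (1 - t ^ 2) := mul_nonneg (by positivity) (by nlinarith)
    nlinarith
  · have h1 : d / 2 ≤ 1 - t ^ 2 := by nlinarith
    have h2 : l ^ 2 * (d / 2) ≤ l ^ 2 * (1 - t ^ 2) :=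
      mul_le_mul_of_nonneg_left h1 (by positivity)
    have h3 : l ^ 2 * (d / 2) = 2 * (l * M) := by linear_combination l / 2 * hld
    nlinarith

lemma exists_pos_mul_rpow_le {A c p : ℝ} (hA : 0 < A) (hc : 0 < c) (hp : 1 < p) :
    ∃ b : ℝ, 0 < b ∧ (b * A) ^ p ≤ b * c := by
  have hb : 0 < c / A ^ p := by positivity
  refine ⟨(c / A ^ p) ^ (p - 1)⁻¹, by positivity, le_of_eq ?_⟩
  have hbp : ((c / A ^ p) ^ (p - 1)⁻¹) ^ (p - 1) = c / A ^ p :=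
    Real.rpow_inv_rpow hb.le (by linarith)
  have hb' : 0 < (c / A ^ p) ^ (p - 1)⁻¹ := by positivity
  generalize (c / A ^ p) ^ (p - 1)⁻¹ = b at hbp hb'
  rw [Real.rpow_sub_one hb'.ne', div_eq_div_iff hb'.ne' (by positivity)] at hbp
  rw [Real.mul_rpow hb'.le hA.le, hbp, mul_comm]

/-- If the complement of a nonempty cone `K ⊆ ℝ^N` contains a nonempty open cone, then
the critical exponent of `-Δu = u^p` on `K` is strictly less than `N/(N-2)`: for some
`1 < p < N/(N-2)` and some `ρ > 0` there is a positive classical supersolution of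
`-Δu = u^p` on `K ∩ {‖x‖ > ρ}`. -/
theorem critical_exponent_less_than_serrin
    (N : ℕ) (hN : 3 ≤ N)
    (K : Set (EuclideanSpace ℝ (Fin N))) (hKopen : IsOpen K)
    (hK0 : K ⊆ {x | x ≠ 0}) (hKcone : ∀ t : ℝ, 0 < t → t • K = K) (hKne : K.Nonempty)
    (K' : Set (EuclideanSpace ℝ (Fin N))) (hK'open : IsOpen K')
    (hK'0 : K' ⊆ {x | x ≠ 0}) (hK'cone : ∀ t : ℝ, 0 < t → t • K' = K')
    (hK'ne : K'.Nonempty) (hdisj : K' ∩ K = ∅) :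
    ∃ p ρ : ℝ, ∃ u : EuclideanSpace ℝ (Fin N) → ℝ,
      1 < p ∧ p < (N : ℝ) / ((N : ℝ) - 2) ∧ 0 < ρ ∧
      ContDiffOn ℝ 2 u {x | x ∈ K ∧ ρ < ‖x‖} ∧
      (∀ x ∈ K, ρ < ‖x‖ → 0 < u x) ∧
      (∀ x ∈ K, ρ < ‖x‖ → -lap u x ≥ u x ^ p) := by
  have hN' : (3 : ℝ) ≤ N := by exact_mod_cast hN
  obtain ⟨e, d, he, hd, hKe⟩ :=
    exists_inner_le_of_disjoint_cones hK0 hKcone hK'open hK'0 hK'cone hK'ne hdisj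
  obtain ⟨l, c, hl, hc, hlc⟩ := exists_pos_le_quadratic (M := N - 1) (by linarith) hd
  set A := 2 * Real.exp l with hA
  have hA0 : 0 < A := by positivity
  set c₁ := Real.exp (-l) * c with hc₁
  have hc₁0 : 0 < c₁ := by positivity
  obtain ⟨s, hs0, hs1, hsA⟩ : ∃ s : ℝ, 0 < s ∧ s ≤ 1 ∧ A * (N - 1) * s ≤ c₁ / 2 := by
    have hB : 0 < A * (N - 1) := mul_pos hA0 (by linarith)
    refine ⟨min 1 (c₁ / 2 / (A * (N - 1))), by positivity, min_le_left _ _, ?_⟩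
    rw [← le_div_iff₀' hB]
    exact min_le_right _ _
  set γ : ℝ := N - 2 + s with hγ
  have hγ0 : 0 < γ := by linarith
  have hp : 1 < 1 + 2 / γ := by simpa using div_pos two_pos hγ0
  obtain ⟨b, hb0, hb⟩ := exists_pos_mul_rpow_le hA0 (half_pos hc₁0) hp
  have hC2 : ∀ x ∈ K, ContDiffAt ℝ 2
      (fun y => b * (A * radialExp e (-γ) 0 y - radialExp e (-γ) l y)) x := fun x hx =>
    contDiffAt_const.mul ((contDiffAt_const.mul (contDiffAt_radialExp e _ _ (hK0 hx))).sub
      (contDiffAt_radialExp e _ _ (hK0 hx)))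
  have hG : ∀ x, radialExp e (-γ) l x =
      radialExp e (-γ) 0 x * Real.exp (l * (⟪e, x⟫ * ‖x‖⁻¹)) := fun x => by
    simp [radialExp, Real.exp_add]
  have hpos : ∀ x, 0 < radialExp e (-γ) 0 x := fun x => Real.exp_pos _
  have ht : ∀ x, -1 ≤ ⟪e, x⟫ * ‖x‖⁻¹ ∧ ⟪e, x⟫ * ‖x‖⁻¹ ≤ 1 := fun x => by
    have h := abs_real_inner_div_norm_mul_norm_le_one e x
    rw [he, one_mul, div_eq_mul_inv] at h
    exact abs_le.mp h
  have hexp : ∀ x, Real.exp (l * (⟪e, x⟫ * ‖x‖⁻¹)) ≤ Real.exp l := fun x =>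
    Real.exp_le_exp.mpr (by nlinarith [(ht x).2])
  have hu0 : ∀ x, 0 < b * (A * radialExp e (-γ) 0 x - radialExp e (-γ) l x) := fun x => by
    rw [hG]
    have h := mul_le_mul_of_nonneg_left (hexp x) (hpos x).le
    have h' := mul_pos (hpos x) (Real.exp_pos l)
    exact mul_pos hb0 (by rw [hA]; linarith)
  refine ⟨1 + 2 / γ, 1, fun y => b * (A * radialExp e (-γ) 0 y - radialExp e (-γ) l y), hp, ?_,
    one_pos, fun x hx => (hC2 x hx.1).contDiffWithinAt, fun x _ _ => hu0 x, fun x hx _ => ?_⟩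
  · have h2 : (N : ℝ) / (N - 2) = 1 + 2 / (N - 2) := by
      have : (N : ℝ) - 2 ≠ 0 := by linarith
      field_simp
      ring
    rw [h2]
    gcongr <;> linarith
  · have hx0 := hK0 hx
    have hxn : 0 < ‖x‖ := norm_pos_iff.mpr hx0
    rw [lap_const_mul_sub (contDiffAt_radialExp e _ _ hx0) (contDiffAt_radialExp e _ _ hx0),
      lap_radialExp he _ _ hx0, lap_radialExp he _ _ hx0]
    have hscale : radialExp e (-γ) 0 x ^ (1 + 2 / γ) = radialExp e (-γ) 0 x * ‖x‖⁻¹ ^ 2 := by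
      rw [Real.rpow_add (hpos x), Real.rpow_one]
      congr 1
      rw [radialExp, ← Real.exp_mul, ← Real.rpow_natCast, Real.rpow_def_of_pos (by positivity),
        Real.log_inv]
      congr 1
      push_cast
      field_simp
      ring
    have hle : (b * (A * radialExp e (-γ) 0 x - radialExp e (-γ) l x)) ^ (1 + 2 / γ) ≤
        b * (c₁ / 2) * (radialExp e (-γ) 0 x * ‖x‖⁻¹ ^ 2) := by
      calc _ ≤ (b * A * radialExp e (-γ) 0 x) ^ (1 + 2 / γ) := by
            refine Real.rpow_le_rpow (hu0 x).le ?_ (by linarith)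
            have : 0 < radialExp e (-γ) l x := Real.exp_pos _
            nlinarith
        _ = (b * A) ^ (1 + 2 / γ) * (radialExp e (-γ) 0 x * ‖x‖⁻¹ ^ 2) := by
            rw [Real.mul_rpow (by positivity) (hpos x).le, hscale]
        _ ≤ _ := mul_le_mul_of_nonneg_right hb (mul_nonneg (hpos x).le (by positivity))
    refine hle.trans ?_
    rw [hG x]
    have hq := hlc _ (ht x).1 (hKe x hx)
    have hexp' : Real.exp (-l) ≤ Real.exp (l * (⟪e, x⟫ * ‖x‖⁻¹)) :=
      Real.exp_le_exp.mpr (by nlinarith [(ht x).1])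
    set t := ⟪e, x⟫ * ‖x‖⁻¹
    have hmain : c₁ / 2 ≤ Real.exp (l * t) * (γ * s + (l ^ 2 * (1 - t ^ 2) - l * (N - 1) * t)) -
        A * (γ * s) := by
      have h1 : c₁ ≤ Real.exp (l * t) * (l ^ 2 * (1 - t ^ 2) - l * (N - 1) * t) :=
        mul_le_mul hexp' hq hc.le (Real.exp_pos _).le
      have h2 : 0 ≤ Real.exp (l * t) * (γ * s) := by positivity
      have h3 : A * (γ * s) ≤ A * (N - 1) * s := by
        rw [mul_assoc A]
        gcongr
        linarith
      linarith
    have hfac : 0 ≤ b * (radialExp e (-γ) 0 x * ‖x‖⁻¹ ^ 2) :=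
      mul_nonneg hb0.le (mul_nonneg (hpos x).le (by positivity))
    have h := mul_le_mul_of_nonneg_left hmain hfac
    have hs : s = γ - (N - 2) := by rw [hγ]; ring
    rw [hs] at h
    refine le_trans (le_of_eq (by ring)) (h.trans (le_of_eq (by ring)))
end
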